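/- arXiv:0710.2233 — 3 statements merged into one kernel-verified Lean document; each statement's English description precedes it below -/
import Mathlib

section
/- Let r, s ∈ ℂ satisfy r·s ≠ 0 and (1+r)·(1+s)·(r-s)·(rs-1) ≠ 0. If the equation (1+r)^m + ((1+r)·s)^m - (1+s)^m - ((1+s)·r)^m = 0 has infinitely many solutions m ∈ ℕ, then at least one of the following three pairs consists of two roots of unity: ((1+r)/(1+s), ((1+s)·r)/((1+r)·s)), or ((1+r)/(r·(1+s)), (1+s)/(s·(1+r))), or (r, s). -/
/-- A root of unity: a complex number `z` with `z ^ n = 1` for some positive integer `n`. -/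
def IsRootOfUnity (z : ℂ) : Prop := ∃ n : ℕ, 0 < n ∧ z ^ n = 1

open Polynomial

/-- In a local ring with `p` in the maximal ideal, integers prime to `p` are units. -/
lemma bep_unit {S : Type*} [CommRing S] [IsLocalRing S] {p : ℕ} (hp : p.Prime)
    (hpm : (p : S) ∈ IsLocalRing.maximalIdeal S) {w : ℕ} (hw : ¬ p ∣ w) : IsUnit (w : S) := by
  by_contra hu
  have hwm : (w : S) ∈ IsLocalRing.maximalIdeal S := hu
  have hc : IsCoprime (p : ℤ) (w : ℤ) :=
    Nat.isCoprime_iff_coprime.2 ((Nat.Prime.coprime_iff_not_dvd hp).2 hw)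
  obtain ⟨u, v, huv⟩ := hc
  have h1 : (u : S) * p + v * w = 1 := by exact_mod_cast congrArg (Int.cast : ℤ → S) huv
  have : (1 : S) ∈ IsLocalRing.maximalIdeal S := by
    rw [← h1]
    exact Ideal.add_mem _ (Ideal.mul_mem_left _ _ hpm) (Ideal.mul_mem_left _ _ hwm)
  exact (Ideal.ne_top_iff_one _).1 (IsLocalRing.maximalIdeal.isMaximal S).ne_top this

lemma bep_nat_dvd {S : Type*} [CommRing S] [IsLocalRing S] {p : ℕ} (hp : p.Prime)
    (hpm : (p : S) ∈ IsLocalRing.maximalIdeal S) {D : ℕ} (hD : D ≠ 0) :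
    (D : S) ∣ (p : S) ^ (D.factorization p) := by
  have h1 := bep_unit hp hpm (Nat.not_dvd_ordCompl hp hD)
  have h2 : (D : S) = (p : S) ^ (D.factorization p) * ((D / p ^ D.factorization p : ℕ) : S) := by
    exact_mod_cast congrArg (Nat.cast : ℕ → S) (Nat.ordProj_mul_ordCompl_eq_self D p).symm
  rw [h2]
  obtain ⟨u, hu⟩ := h1
  rw [← hu]
  exact (Units.mul_right_dvd).2 dvd_rfl

lemma bep_int_dvd {S : Type*} [CommRing S] [IsLocalRing S] {p : ℕ} (hp : p.Prime)
    (hpm : (p : S) ∈ IsLocalRing.maximalIdeal S) {D : ℤ} (hD : D ≠ 0) :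
    ∃ s : ℕ, (D : S) ∣ (p : S) ^ s := by
  refine ⟨_, dvd_trans ?_ (bep_nat_dvd hp hpm (Int.natAbs_ne_zero.2 hD))⟩
  have h : D ∣ (D.natAbs : ℤ) := Int.dvd_natAbs.2 dvd_rfl
  have h2 := map_dvd (Int.castRingHom S) h
  simpa only [eq_intCast, Int.cast_natCast] using h2

lemma bep_fact_dvd {S : Type*} [CommRing S] [IsLocalRing S] {p : ℕ} (hp : p.Prime)
    (hpm : (p : S) ∈ IsLocalRing.maximalIdeal S) (k : ℕ) :
    ((k.factorial : ℕ) : S) ∣ (p : S) ^ k := by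
  refine (bep_nat_dvd hp hpm k.factorial_ne_zero).trans (pow_dvd_pow _ ?_)
  have := Fact.mk hp
  rw [Nat.factorization_def _ hp]
  by_cases hk : k = 0
  · simp [hk]
  · have := sub_one_mul_padicValNat_factorial (p := p) k
    have h2 : 1 ≤ p - 1 := by have := hp.two_le; omega
    nlinarith [Nat.sub_le k (p.digits k).sum]

lemma bep_newton {S : Type*} [CommRing S] [IsDomain S] [CharZero S] [IsLocalRing S]
    {p : ℕ} (hp : p.Prime)
    (hpm : (p : S) ∈ IsLocalRing.maximalIdeal S) (Z : Finset ℕ) :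
    ∃ L : ℕ, ∀ Q : S[X], (∀ z ∈ Z, (p : S) ^ L ∣ Q.eval ((p : S) * z)) →
      ∀ n : ℕ, (p : S) ^ Z.card ∣ Q.eval ((p : S) * n) := by
  have hp0 : (p : S) ≠ 0 := by exact_mod_cast hp.ne_zero
  induction Z using Finset.induction_on with
  | empty => exact ⟨0, fun Q _ n => by simp⟩
  | insert z Z hz ih =>
    obtain ⟨L, hL⟩ := ih
    have hD : (∏ y ∈ Z, ((y : ℤ) - z)) ≠ 0 := by
      rw [Finset.prod_ne_zero_iff]
      intro y hy h0
      have : y = z := by omega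
      exact hz (this ▸ hy)
    obtain ⟨s, hs⟩ := bep_int_dvd hp hpm hD
    refine ⟨max (Z.card + 1) (L + (s + 1)), fun Q hQ n => ?_⟩
    rw [Finset.card_insert_of_notMem hz]
    have hz1 := hQ z (Finset.mem_insert_self _ _)
    obtain ⟨Q1, hQ1⟩ : ((X : S[X]) - C ((p : S) * z)) ∣ Q - C (Q.eval ((p : S) * z)) :=
      X_sub_C_dvd_sub_C_eval
    have hev : ∀ t : ℕ, Q.eval ((p : S) * t) =
        (p : S) * ((t : S) - z) * Q1.eval ((p : S) * t) + Q.eval ((p : S) * z) := by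
      intro t
      have := congrArg (eval ((p : S) * t)) hQ1
      simp only [eval_sub, eval_C, eval_mul, eval_X] at this
      linear_combination this
    have h1 : ∀ y ∈ Z, (p : S) ^ L ∣ Q1.eval ((p : S) * y) := by
      intro y hy
      have h2 : (p : S) ^ (L + (s + 1)) ∣ Q.eval ((p : S) * y) :=
        (pow_dvd_pow _ (le_max_right _ _)).trans (hQ y (Finset.mem_insert_of_mem hy))
      have h3 : (p : S) ^ (L + (s + 1)) ∣ Q.eval ((p : S) * z) :=
        (pow_dvd_pow _ (le_max_right _ _)).trans hz1
      have h4 : (p : S) ^ (L + (s + 1)) ∣ (p : S) * ((y : S) - z) * Q1.eval ((p : S) * y) := by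
        have := dvd_sub h2 h3
        rwa [hev y, add_sub_cancel_right] at this
      have h5 : ((y : S) - z) ∣ (p : S) ^ s := by
        refine dvd_trans ?_ hs
        have := map_dvd (Int.castRingHom S) (Finset.dvd_prod_of_mem (fun y : ℕ => (y : ℤ) - z) hy)
        simpa using this
      obtain ⟨v, hv⟩ := h5
      have h6 : (p : S) ^ (L + (s + 1)) ∣ (p : S) ^ (s + 1) * Q1.eval ((p : S) * y) := by
        have := h4.mul_left v
        convert this using 1
        rw [pow_succ, hv]; ring
      rw [pow_add, mul_comm] at h6
      exact (mul_dvd_mul_iff_left (pow_ne_zero _ hp0)).1 h6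
    have h7 := hL Q1 h1 n
    rw [hev n]
    refine dvd_add ?_ ((pow_dvd_pow _ (le_max_left _ _)).trans hz1)
    rw [pow_succ, mul_comm, mul_assoc]
    exact mul_dvd_mul_left _ (h7.mul_left _)

/-- Hansel style vanishing statement. -/
lemma bep_hansel {S : Type*} [CommRing S] [IsDomain S] [CharZero S] [IsLocalRing S]
    [IsNoetherianRing S] {p : ℕ} (hp : p.Prime)
    (hpm : (p : S) ∈ IsLocalRing.maximalIdeal S) {ι : Type*} [Fintype ι]
    (c u : ι → S) (hinf : {n : ℕ | ∑ i, c i * (1 + (p : S) ^ 2 * u i) ^ n = 0}.Infinite) (n : ℕ) :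
    ∑ i, c i * (1 + (p : S) ^ 2 * u i) ^ n = 0 := by
  choose d hd using fun k => bep_fact_dvd (S := S) hp hpm k
  -- the approximating polynomials
  let Q : ℕ → S[X] := fun K => ∑ k ∈ Finset.range K,
    C (d k * ∑ i, c i * u i ^ k) * ∏ j ∈ Finset.range k, (X - C ((p : S) * j))
  have key : ∀ (k n : ℕ), (p : S) ^ k * ∏ j ∈ Finset.range k, ((n : S) - j) =
      ∏ j ∈ Finset.range k, ((p : S) * n - p * j) := by
    intro k n
    rw [← Finset.card_range k, ← Finset.prod_const, Finset.card_range, ← Finset.prod_mul_distrib]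
    exact Finset.prod_congr rfl fun j _ => by ring
  have hdesc : ∀ (k n : ℕ), ∏ j ∈ Finset.range k, ((n : S) - j) =
      (k.factorial : S) * (n.choose k : S) := by
    intro k n
    rw [← Nat.cast_mul, ← Nat.descFactorial_eq_factorial_mul_choose]
    rw [Nat.descFactorial_eq_prod_range]
    by_cases hkn : k ≤ n
    · push_cast
      refine Finset.prod_congr rfl fun j hj => ?_
      rw [Nat.cast_sub (by have := Finset.mem_range.1 hj; omega)]
    · rw [Finset.prod_eq_zero (i := n) (by simp; omega) (by simp)]
      rw [Finset.prod_eq_zero (i := n) (by simp; omega) (by simp)]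
      simp
  have hterm : ∀ (k n : ℕ), (d k * ∑ i, c i * u i ^ k) *
      ∏ j ∈ Finset.range k, ((p : S) * n - p * j) =
      ∑ i, c i * ((p : S) ^ 2 * u i) ^ k * (n.choose k : S) := by
    intro k n
    rw [← key, hdesc]
    have : (d k * ∑ i, c i * u i ^ k) * ((p : S) ^ k * (k.factorial * (n.choose k : S))) =
      (p : S) ^ k * (k.factorial * d k) * (n.choose k : S) * ∑ i, c i * u i ^ k := by ring
    rw [this, ← hd, Finset.mul_sum]
    refine Finset.sum_congr rfl fun i _ => ?_
    rw [mul_pow, ← pow_mul, two_mul, pow_add]; ring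
  have hf : ∀ (n M : ℕ), n < M → ∑ i, c i * (1 + (p : S) ^ 2 * u i) ^ n =
      ∑ k ∈ Finset.range M, ∑ i, c i * ((p : S) ^ 2 * u i) ^ k * (n.choose k : S) := by
    intro n M hM
    rw [Finset.sum_comm]
    refine Finset.sum_congr rfl fun i _ => ?_
    rw [add_comm, add_pow, Finset.mul_sum]
    have hsub : Finset.range (n + 1) ⊆ Finset.range M := by
      intro a ha; simp at *; omega
    rw [← Finset.sum_subset hsub]
    · refine Finset.sum_congr rfl fun k _ => by simp; ring
    · intro k _ hk
      rw [Nat.choose_eq_zero_of_lt (by simpa using hk)]; simp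
  have happ : ∀ K n : ℕ, (p : S) ^ K ∣
      ∑ i, c i * (1 + (p : S) ^ 2 * u i) ^ n - (Q K).eval ((p : S) * n) := by
    intro K n
    have hQ : (Q K).eval ((p : S) * n) = ∑ k ∈ Finset.range K,
        ∑ i, c i * ((p : S) ^ 2 * u i) ^ k * (n.choose k : S) := by
      simp only [Q, eval_finsetSum, eval_mul, eval_C, eval_prod, eval_sub, eval_X]
      exact Finset.sum_congr rfl fun k _ => hterm k n
    rw [hQ, hf n (K + (n + 1)) (by omega), Finset.sum_range_add, add_sub_cancel_left]
    refine Finset.dvd_sum fun k _ => Finset.dvd_sum fun i _ => ?_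
    refine Dvd.dvd.mul_right (Dvd.dvd.mul_left ?_ _) _
    rw [mul_pow, ← pow_mul]
    exact Dvd.dvd.mul_right (pow_dvd_pow _ (by omega)) _
  have hall : ∀ t : ℕ, (p : S) ^ t ∣ ∑ i, c i * (1 + (p : S) ^ 2 * u i) ^ n := by
    intro t
    obtain ⟨Z, hZ, hZt⟩ := hinf.exists_subset_card_eq t
    obtain ⟨L, hL⟩ := bep_newton hp hpm Z
    have h1 : ∀ z ∈ Z, (p : S) ^ L ∣ (Q (max L t)).eval ((p : S) * z) := by
      intro z hz
      have h2 := happ (max L t) z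
      have h3 : ∑ i, c i * (1 + (p : S) ^ 2 * u i) ^ z = 0 := hZ hz
      rw [h3, zero_sub, dvd_neg] at h2
      exact (pow_dvd_pow _ (le_max_left _ _)).trans h2
    have h4 := hL _ h1 n
    rw [hZt] at h4
    exact (dvd_sub_left h4).1 ((pow_dvd_pow _ (le_max_right _ _)).trans (happ (max L t) n))
  have hne : Ideal.span {(p : S)} ≠ ⊤ := by
    rw [Ne, Ideal.span_singleton_eq_top]; exact hpm
  have := Ideal.iInf_pow_eq_bot_of_isDomain _ hne
  rw [← Ideal.mem_bot, ← this, Ideal.mem_iInf]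
  intro t
  rw [Ideal.span_singleton_pow, Ideal.mem_span_singleton]
  exact hall t

lemma bep_pow_cong {S : Type*} [CommRing S] {p : ℕ} {x a : S} (hx : x ∣ (p : S))
    (ha : x ∣ a - 1) (j : ℕ) : x ^ (j + 1) ∣ a ^ (p ^ j) - 1 := by
  induction j with
  | zero => simpa using ha
  | succ j ih =>
    rw [pow_succ p, pow_mul, pow_succ x (j + 1)]
    set b := a ^ (p ^ j) with hb
    have h1 : x ∣ b - 1 := (Dvd.intro_left _ (pow_succ x j).symm).trans ih
    have h2 : b ^ p - 1 = (b - 1) * ∑ i ∈ Finset.range p, b ^ i := (mul_geom_sum b p).symm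
    rw [h2]
    refine mul_dvd_mul ih ?_
    have h3 : ∑ i ∈ Finset.range p, b ^ i = ∑ i ∈ Finset.range p, (b ^ i - 1) + p := by
      simp
    rw [h3]
    refine dvd_add (Finset.dvd_sum fun i _ => h1.trans ?_) hx
    simpa using sub_dvd_pow_sub_pow b 1 i

lemma bep_pow_dvd {R : Type*} [CommRing R] [IsDomain R] [CharZero R] [IsNoetherianRing R]
    (P : Ideal R) [P.IsPrime] {x : R} {p : ℕ} (hp : p.Prime)
    (hP : P ∈ (Ideal.span {x}).minimalPrimes) :
    ∃ e : ℕ, (p : Localization.AtPrime P) ∣ (algebraMap R (Localization.AtPrime P) x) ^ e := by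
  have hxP : x ∈ P := hP.1.2 (Ideal.mem_span_singleton_self x)
  have hht : P.height ≤ 1 := Ideal.height_le_one_of_isPrincipal_of_mem_minimalPrimes _ P hP
  have hrad : algebraMap R (Localization.AtPrime P) x ∈
      (Ideal.span {(p : Localization.AtPrime P)}).radical := by
    rw [Ideal.radical_eq_sInf, Ideal.mem_sInf]
    rintro Q ⟨hQ, hQp⟩
    have hpQ : (p : Localization.AtPrime P) ∈ Q := hQ (Ideal.mem_span_singleton_self _)
    have hQ'p : (Q.comap (algebraMap R (Localization.AtPrime P))).IsPrime := Ideal.comap_isPrime _ _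
    have hle : Q.comap (algebraMap R (Localization.AtPrime P)) ≤ P := by
      have h1 := IsLocalRing.le_maximalIdeal hQp.ne_top
      intro y hy
      exact (IsLocalization.AtPrime.to_map_mem_maximal_iff (Localization.AtPrime P) P y).1 (h1 hy)
    by_contra hxQ
    have hlt : Q.comap (algebraMap R (Localization.AtPrime P)) < P :=
      lt_of_le_of_ne hle fun h => hxQ (by
        have : x ∈ Q.comap (algebraMap R (Localization.AtPrime P)) := h.ge hxP
        exact this)
    have hbot : (⊥ : Ideal R) < Q.comap (algebraMap R (Localization.AtPrime P)) := by
      refine bot_lt_iff_ne_bot.2 fun h => ?_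
      have : (p : R) ∈ Q.comap (algebraMap R (Localization.AtPrime P)) := by
        simpa using hpQ
      rw [h, Ideal.mem_bot] at this
      exact hp.ne_zero (by exact_mod_cast this)
    have h3 := Ideal.height_add_one_le_of_lt_of_isPrime hlt
    have h4 := Ideal.height_add_one_le_of_lt_of_isPrime hbot
    have h5 : (2 : ℕ∞) ≤ 1 := by
      calc (2 : ℕ∞) = 0 + 1 + 1 := by norm_num
        _ ≤ (⊥ : Ideal R).height + 1 + 1 := by gcongr; exact zero_le
        _ ≤ _ := by gcongr
        _ ≤ P.height := h3
        _ ≤ 1 := hht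
    exact absurd h5 (by decide)
  obtain ⟨e, he⟩ := hrad
  exact ⟨e, Ideal.mem_span_singleton.1 he⟩

lemma bep_sml {R : Type*} [CommRing R] [IsDomain R] [CharZero R] [IsNoetherianRing R]
    {x : R} (hx : ¬ IsUnit x) {p : ℕ} (hp : p.Prime) (hxp : x ∣ (p : R))
    {ι : Type*} [Fintype ι] (c α : ι → R) {N : ℕ} (hN : 0 < N) (hα : ∀ i, x ∣ α i ^ N - 1)
    (hinf : {m : ℕ | ∑ i, c i * α i ^ m = 0}.Infinite) :
    ∃ q : ℕ, 0 < q ∧ ∃ l : ℕ, ∀ n : ℕ, ∑ i, c i * α i ^ (l + q * n) = 0 := by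
  have hne : Ideal.span {x} ≠ ⊤ := by rwa [Ne, Ideal.span_singleton_eq_top]
  obtain ⟨P, hP⟩ := Ideal.nonempty_minimalPrimes hne
  have hPp : P.IsPrime := hP.1.1
  obtain ⟨e, he⟩ := bep_pow_dvd P hp hP
  have hxP : x ∈ P := hP.1.2 (Ideal.mem_span_singleton_self x)
  have hinj : Function.Injective (algebraMap R (Localization.AtPrime P)) :=
    IsLocalization.injective _ P.primeCompl_le_nonZeroDivisors
  have hdom : IsDomain (Localization.AtPrime P) :=
    IsLocalization.isDomain_localization P.primeCompl_le_nonZeroDivisors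
  have hnoeth : IsNoetherianRing (Localization.AtPrime P) :=
    IsLocalization.isNoetherianRing P.primeCompl _ inferInstance
  have hchar : CharZero (Localization.AtPrime P) := charZero_of_injective_algebraMap hinj
  set φ := algebraMap R (Localization.AtPrime P) with hφ
  have hpm : (p : Localization.AtPrime P) ∈ IsLocalRing.maximalIdeal (Localization.AtPrime P) := by
    have h1 : (p : R) ∈ P := Ideal.mem_of_dvd _ hxp hxP
    have h2 := (IsLocalization.AtPrime.to_map_mem_maximal_iff (Localization.AtPrime P) P (p : R)).2 h1
    simpa using h2
  have hxp' : φ x ∣ (p : Localization.AtPrime P) := by simpa using map_dvd φ hxp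
  let q := N * p ^ (2 * e)
  have hq : 0 < q := Nat.mul_pos hN (pow_pos hp.pos _)
  have hu : ∀ i, ∃ u, φ (α i) ^ q = 1 + (p : Localization.AtPrime P) ^ 2 * u := by
    intro i
    have h1 : φ x ∣ φ (α i) ^ N - 1 := by simpa using map_dvd φ (hα i)
    have h2 := bep_pow_cong hxp' h1 (2 * e)
    rw [← pow_mul] at h2
    have h3 : (p : Localization.AtPrime P) ^ 2 ∣ φ x ^ (2 * e + 1) := by
      rw [pow_succ (φ x), mul_comm 2 e, pow_mul (φ x)]
      exact (pow_dvd_pow_of_dvd he 2).mul_right _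
    obtain ⟨u, hu⟩ := h3.trans h2
    exact ⟨u, by rw [← hu]; simp [q]⟩
  choose u hu using hu
  -- pigeonhole on the residue class modulo q
  obtain ⟨l, hl⟩ : ∃ l : ℕ, {n : ℕ | ∑ i, c i * α i ^ (l + q * n) = 0}.Infinite := by
    by_contra hcon
    push Not at hcon
    refine hinf ?_
    have hfin : (⋃ l ∈ Finset.range q, (fun n => l + q * n) ''
        {n : ℕ | ∑ i, c i * α i ^ (l + q * n) = 0}).Finite :=
      Set.Finite.biUnion (Finset.finite_toSet _) fun l _ =>
        (by simpa using hcon l : Set.Finite _).image _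
    refine hfin.subset fun m hm => ?_
    simp only [Set.mem_iUnion]
    refine ⟨m % q, Finset.mem_range.2 (Nat.mod_lt _ hq), m / q, ?_, Nat.mod_add_div m q⟩
    simp only [Set.mem_ofPred_eq, Nat.mod_add_div]
    exact hm
  refine ⟨q, hq, l, ?_⟩
  have htr : ∀ n : ℕ, φ (∑ i, c i * α i ^ (l + q * n)) =
      ∑ i, (φ (c i) * φ (α i) ^ l) * (1 + (p : Localization.AtPrime P) ^ 2 * u i) ^ n := by
    intro n
    simp only [map_sum, map_mul, map_pow]
    refine Finset.sum_congr rfl fun i _ => ?_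
    rw [← hu, ← pow_mul, pow_add, ← mul_assoc]
  intro n
  apply hinj
  rw [map_zero, htr]
  refine bep_hansel hp hpm _ u (hl.mono fun m hm => ?_) n
  rw [Set.mem_ofPred_eq] at hm ⊢
  rw [← htr, hm, map_zero]

lemma bep_jacobson_int : IsJacobsonRing ℤ := by
  rw [isJacobsonRing_iff_prime_eq]
  intro P hP
  by_cases h : P = ⊥
  · subst h
    refine le_antisymm (fun x hx => ?_) Ideal.le_jacobson
    rw [Ideal.mem_jacobson_bot] at hx
    rw [Ideal.mem_bot]
    by_contra hx0
    have h1 : 0 < x * x := mul_self_pos.2 hx0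
    rcases Int.isUnit_iff.1 (hx (3 * x)) with h2 | h2 <;> nlinarith
  · have := hP.isMaximal h
    exact Ideal.jacobson_eq_self_of_isMaximal

lemma bep_finite_field {F : Type*} [Field F] (f : ℤ →+* F) (hf : f.FiniteType) : Finite F := by
  have hfin : Module.Finite ℤ F := by
    rw [Subsingleton.elim f (algebraMap ℤ F)] at hf
    have : Algebra.FiniteType ℤ F := RingHom.finiteType_algebraMap.1 hf
    have := bep_jacobson_int
    exact finite_of_finite_type_of_isJacobsonRing ℤ F
  obtain ⟨p, hp⟩ := CharP.exists F
  have hp0 : p ≠ 0 := by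
    rintro rfl
    have : CharZero F := CharP.charP_to_charZero F
    have : Algebra.IsIntegral ℤ F := inferInstance
    exact Int.not_isField (isField_of_isIntegral_of_isField
      (FaithfulSMul.algebraMap_injective ℤ F) (Field.toIsField F))
  have : NeZero p := ⟨hp0⟩
  have hpp : Fact p.Prime := ⟨(CharP.char_is_prime_or_zero F p).resolve_right hp0⟩
  let := ZMod.algebra F p
  have : Module.Finite (ZMod p) F := Module.Finite.of_restrictScalars_finite ℤ (ZMod p) F
  exact Module.finite_of_finite (ZMod p)

lemma bep_ring {ι : Type*} [Fintype ι] (a : ι → ℂ) (ha : ∀ i, a i ≠ 0) :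
    ∃ (R : Subalgebra ℤ ℂ) (x : R) (α : ι → R) (p N : ℕ), p.Prime ∧ IsNoetherianRing R ∧
      ¬ IsUnit x ∧ x ∣ (p : R) ∧ 0 < N ∧ (∀ i, (α i : ℂ) = a i) ∧ ∀ i, x ∣ α i ^ N - 1 := by
  classical
  let G : Finset ℂ := Finset.univ.image a ∪ Finset.univ.image (fun i => (a i)⁻¹)
  obtain ⟨R, hRG⟩ : ∃ R, R = Algebra.adjoin ℤ (G : Set ℂ) := ⟨_, rfl⟩
  have hft : Algebra.FiniteType ℤ R := (Subalgebra.fg_iff_finiteType _).1 ⟨G, hRG.symm⟩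
  have hnoe : IsNoetherianRing R := Algebra.FiniteType.isNoetherianRing ℤ R
  have haR : ∀ i, a i ∈ R := fun i => hRG ▸ Algebra.subset_adjoin (by simp [G])
  have haR' : ∀ i, (a i)⁻¹ ∈ R := fun i => hRG ▸ Algebra.subset_adjoin (by simp [G])
  obtain ⟨M, hM⟩ := Ideal.exists_maximal R
  let : Field (R ⧸ M) := Ideal.Quotient.field M
  have hfin : Finite (R ⧸ M) :=
    bep_finite_field ((Ideal.Quotient.mk M).comp (algebraMap ℤ R))
      ((RingHom.FiniteType.of_surjective _ Ideal.Quotient.mk_surjective).comp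
        (RingHom.finiteType_algebraMap.2 hft))
  let := Fintype.ofFinite (R ⧸ M)
  obtain ⟨p, hpc⟩ := CharP.exists (R ⧸ M)
  have hp : p.Prime := CharP.char_is_prime (R ⧸ M) p
  have hpM : (p : R) ∈ M := by
    rw [← Ideal.Quotient.eq_zero_iff_mem]
    simp
  have haM : ∀ i, (⟨a i, haR i⟩ : R) ^ (Fintype.card (R ⧸ M) - 1) - 1 ∈ M := by
    intro i
    rw [← Ideal.Quotient.eq_zero_iff_mem, map_sub, map_pow, map_one, sub_eq_zero]
    refine FiniteField.pow_card_sub_one_eq_one _ ?_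
    have hu : IsUnit (⟨a i, haR i⟩ : R) :=
      IsUnit.of_mul_eq_one ⟨(a i)⁻¹, haR' i⟩ (Subtype.ext (mul_inv_cancel₀ (ha i)))
    exact (hu.map (Ideal.Quotient.mk M)).ne_zero
  obtain ⟨V, hRV, hMV⟩ := Ideal.image_subset_nonunits_valuationSubring (A := R.toSubring) M hM.ne_top
  obtain ⟨T, hT⟩ : M.FG := IsNoetherian.noetherian M
  have hTne : T.Nonempty := by
    rw [Finset.nonempty_iff_ne_empty]
    rintro rfl
    rw [Finset.coe_empty, Ideal.span_empty] at hT
    rw [← hT, Ideal.mem_bot] at hpM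
    exact hp.ne_zero (by exact_mod_cast hpM)
  obtain ⟨x, hxT, hxmax⟩ := Finset.exists_max_image T (fun t => V.valuation (t : ℂ)) hTne
  have hxM : x ∈ M := hT ▸ Submodule.subset_span hxT
  have hx0 : (x : ℂ) ≠ 0 := by
    intro hx0
    have h1 : M ≤ ⊥ := by
      rw [← hT, Submodule.span_le]
      intro t ht
      have h2 := hxmax t ht
      rw [hx0, map_zero] at h2
      have h3 : (t : ℂ) = 0 := by
        simpa using le_antisymm h2 zero_le
      simpa using h3
    have h4 := h1 hpM
    rw [Ideal.mem_bot] at h4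
    exact hp.ne_zero (by exact_mod_cast h4)
  let G' : Finset ℂ := G ∪ T.image (fun t : R => (t : ℂ) / x)
  obtain ⟨R', hRG'⟩ : ∃ R', R' = Algebra.adjoin ℤ (G' : Set ℂ) := ⟨_, rfl⟩
  have hft' : Algebra.FiniteType ℤ R' := (Subalgebra.fg_iff_finiteType _).1 ⟨G', hRG'.symm⟩
  have hRR' : R ≤ R' := by
    rw [hRG, hRG']
    exact Algebra.adjoin_mono (by simp [G'])
  have hR'V : ∀ y ∈ R', y ∈ V := by
    intro y hy
    rw [hRG'] at hy
    induction hy using Algebra.adjoin_induction with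
    | mem y hy =>
      simp only [G', Finset.coe_union, Set.mem_union, Finset.mem_coe, Finset.mem_image] at hy
      rcases hy with hy | ⟨t, ht, rfl⟩
      · exact hRV (by
          rw [hRG]
          exact Algebra.subset_adjoin hy)
      · rw [← V.valuation_le_one_iff, map_div₀]
        exact div_le_one_of_le₀ (hxmax t ht) zero_le
    | algebraMap n => simp
    | add y z _ _ h1 h2 => exact add_mem h1 h2
    | mul y z _ _ h1 h2 => exact mul_mem h1 h2
  have hMx : ∀ m : R, m ∈ M → (m : ℂ) / x ∈ R' := by
    intro m hm
    rw [← hT] at hm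
    induction hm using Submodule.span_induction with
    | mem t ht =>
      rw [hRG']
      refine Algebra.subset_adjoin ?_
      simp only [G', Finset.coe_union, Set.mem_union, Finset.mem_coe, Finset.mem_image]
      exact Or.inr ⟨t, ht, rfl⟩
    | zero => simp
    | add y z _ _ h1 h2 => 
      push_cast
      rw [add_div]; exact add_mem h1 h2
    | smul b y _ h1 =>
      have : ((b • y : R) : ℂ) / x = (b : ℂ) * ((y : ℂ) / x) := by
        rw [smul_eq_mul]; push_cast; ring
      rw [this]
      exact mul_mem (hRR' b.2) h1
  have hdvd : ∀ m : R, m ∈ M → (⟨x, hRR' x.2⟩ : R') ∣ ⟨m, hRR' m.2⟩ := by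
    intro m hm
    refine ⟨⟨_, hMx m hm⟩, Subtype.ext ?_⟩
    exact (mul_div_cancel₀ _ hx0).symm
  refine ⟨R', ⟨x, hRR' x.2⟩, fun i => ⟨a i, hRR' (haR i)⟩, p, Fintype.card (R ⧸ M) - 1, hp,
    Algebra.FiniteType.isNoetherianRing ℤ R', ?_, ?_, ?_, fun i => rfl, ?_⟩
  · intro hu
    obtain ⟨y, hy⟩ := isUnit_iff_exists_inv.1 hu
    have hxy : (x : ℂ) * y = 1 := congrArg Subtype.val hy
    have h1 : (x : ℂ) ∈ V.nonunits := hMV ⟨x, hxM, rfl⟩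
    rw [ValuationSubring.mem_nonunits_iff] at h1
    have h2 := (V.valuation_le_one_iff _).2 (hR'V y y.2)
    have h3 := congrArg V.valuation hxy
    rw [map_mul, map_one] at h3
    exact absurd h3 (ne_of_lt (mul_lt_one_of_lt_of_le h1 h2))
  · exact hdvd (p : R) hpM
  · have := Fintype.one_lt_card (α := R ⧸ M)
    omega
  · intro i
    exact hdvd _ (haM i)

lemma bep_sml_complex {ι : Type*} [Fintype ι] (a : ι → ℂ) (ha : ∀ i, a i ≠ 0) (c : ι → ℤ)
    (hinf : {m : ℕ | ∑ i, (c i : ℂ) * a i ^ m = 0}.Infinite) :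
    ∃ q : ℕ, 0 < q ∧ ∃ l : ℕ, ∀ n : ℕ, ∑ i, (c i : ℂ) * a i ^ (l + q * n) = 0 := by
  obtain ⟨R, x, α, p, N, hp, hR, hx, hxp, hN, hα, hα'⟩ := bep_ring a ha
  have htr : ∀ m : ℕ, ((∑ i, (c i : R) * α i ^ m : R) : ℂ) = ∑ i, (c i : ℂ) * a i ^ m := by
    intro m
    push_cast
    simp only [hα]
  obtain ⟨q, hq, l, hl⟩ := bep_sml hx hp hxp (fun i => (c i : R)) α hN hα'
    (hinf.mono fun m hm => Subtype.ext (by rw [htr]; exact hm))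
  refine ⟨q, hq, l, fun n => ?_⟩
  rw [← htr, hl]; rfl

lemma bep_vandermonde {a b c d A B C D : ℂ} (ha : a ≠ 0)
    (h : ∀ n : ℕ, a * A ^ n + b * B ^ n + c * C ^ n + d * D ^ n = 0) :
    A = B ∨ A = C ∨ A = D := by
  have h0 := h 0
  have h1 := h 1
  have h2 := h 2
  have h3 := h 3
  have : a * ((A - B) * ((A - C) * (A - D))) = 0 := by
    linear_combination h3 - (B + C + D) * h2 + (B * C + B * D + C * D) * h1 - B * C * D * h0
  rcases mul_eq_zero.1 this with h | h
  · exact absurd h ha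
  rcases mul_eq_zero.1 h with h | h
  · exact Or.inl (sub_eq_zero.1 h)
  rcases mul_eq_zero.1 h with h | h
  · exact Or.inr (Or.inl (sub_eq_zero.1 h))
  · exact Or.inr (Or.inr (sub_eq_zero.1 h))

theorem B_equation_pairs (r s : ℂ) (hrs : r * s ≠ 0)
    (h : (1 + r) * (1 + s) * (r - s) * (r * s - 1) ≠ 0)
    (hinf : {m : ℕ | (1 + r) ^ m + ((1 + r) * s) ^ m
      - (1 + s) ^ m - ((1 + s) * r) ^ m = 0}.Infinite) :
    (IsRootOfUnity ((1 + r) / (1 + s)) ∧ IsRootOfUnity (((1 + s) * r) / ((1 + r) * s))) ∨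
    (IsRootOfUnity ((1 + r) / (r * (1 + s))) ∧ IsRootOfUnity ((1 + s) / (s * (1 + r)))) ∨
    (IsRootOfUnity r ∧ IsRootOfUnity s) := by
  have hr : r ≠ 0 := left_ne_zero_of_mul hrs
  have hs : s ≠ 0 := right_ne_zero_of_mul hrs
  have h12 : (1 + r) * (1 + s) ≠ 0 := left_ne_zero_of_mul (left_ne_zero_of_mul h)
  have hr1 : 1 + r ≠ 0 := left_ne_zero_of_mul h12
  have hs1 : 1 + s ≠ 0 := right_ne_zero_of_mul h12
  obtain ⟨q, hq, l, hl⟩ := bep_sml_complex ![1 + r, (1 + r) * s, 1 + s, (1 + s) * r]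
    (by intro i; fin_cases i <;> simp [hr, hs, hr1, hs1]) ![1, 1, -1, -1]
    (hinf.mono fun m hm => by
      simp only [Set.mem_ofPred_eq] at hm ⊢
      rw [← hm, Fin.sum_univ_four]
      simp
      ring)
  have hl' : ∀ n : ℕ, (1 + r) ^ l * ((1 + r) ^ q) ^ n + ((1 + r) * s) ^ l * (((1 + r) * s) ^ q) ^ n
      + (-(1 + s) ^ l) * ((1 + s) ^ q) ^ n + (-((1 + s) * r) ^ l) * (((1 + s) * r) ^ q) ^ n = 0 := by
    intro n
    have := hl n
    rw [Fin.sum_univ_four] at this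
    simp only [Matrix.cons_val, Int.cast_one, Int.cast_neg, pow_add, pow_mul] at this
    linear_combination this
  have hA0 : (1 + r) ^ l ≠ 0 := pow_ne_zero _ hr1
  have hB0 : ((1 + r) * s) ^ l ≠ 0 := pow_ne_zero _ (mul_ne_zero hr1 hs)
  have hC0 : -(1 + s) ^ l ≠ 0 := neg_ne_zero.2 (pow_ne_zero _ hs1)
  have hD0 : -((1 + s) * r) ^ l ≠ 0 := neg_ne_zero.2 (pow_ne_zero _ (mul_ne_zero hs1 hr))
  have eA := bep_vandermonde hA0 hl'
  have eB := bep_vandermonde hB0 (A := ((1 + r) * s) ^ q) (b := (1 + r) ^ l) (B := (1 + r) ^ q)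
    fun n => (by linear_combination hl' n : _ + _ * _ + (-(1 + s) ^ l) * ((1 + s) ^ q) ^ n +
      (-((1 + s) * r) ^ l) * (((1 + s) * r) ^ q) ^ n = 0)
  have eC := bep_vandermonde hC0 (A := (1 + s) ^ q) (b := (1 + r) ^ l) (B := (1 + r) ^ q)
    fun n => (by linear_combination hl' n : _ + _ * _ + ((1 + r) * s) ^ l * (((1 + r) * s) ^ q) ^ n +
      (-((1 + s) * r) ^ l) * (((1 + s) * r) ^ q) ^ n = 0)
  have eD := bep_vandermonde hD0 (A := ((1 + s) * r) ^ q) (b := (1 + r) ^ l) (B := (1 + r) ^ q)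
    fun n => (by linear_combination hl' n : _ + _ * _ + ((1 + r) * s) ^ l * (((1 + r) * s) ^ q) ^ n +
      (-(1 + s) ^ l) * ((1 + s) ^ q) ^ n = 0)
  have hdiv : ∀ x y : ℂ, y ≠ 0 → x ^ q = y ^ q → IsRootOfUnity (x / y) := fun x y hy hxy =>
    ⟨q, hq, by rw [div_pow, hxy, div_self (pow_ne_zero _ hy)]⟩
  have fAB : (1 + r) ^ q = ((1 + r) * s) ^ q → IsRootOfUnity s := fun hh => by
    have := hdiv _ _ hr1 hh.symm
    rwa [mul_div_cancel_left₀ _ hr1] at this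
  have fCD : (1 + s) ^ q = ((1 + s) * r) ^ q → IsRootOfUnity r := fun hh => by
    have := hdiv _ _ hs1 hh.symm
    rwa [mul_div_cancel_left₀ _ hs1] at this
  have fAC : (1 + r) ^ q = (1 + s) ^ q → IsRootOfUnity ((1 + r) / (1 + s)) := hdiv _ _ hs1
  have fBD : ((1 + r) * s) ^ q = ((1 + s) * r) ^ q →
      IsRootOfUnity (((1 + s) * r) / ((1 + r) * s)) := fun hh => hdiv _ _ (mul_ne_zero hr1 hs) hh.symm
  have fAD : (1 + r) ^ q = ((1 + s) * r) ^ q → IsRootOfUnity ((1 + r) / (r * (1 + s))) :=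
    fun hh => hdiv _ _ (mul_ne_zero hr hs1) (by rw [hh, mul_comm])
  have fBC : ((1 + r) * s) ^ q = (1 + s) ^ q → IsRootOfUnity ((1 + s) / (s * (1 + r))) :=
    fun hh => hdiv _ _ (mul_ne_zero hs hr1) (by rw [← hh, mul_comm])
  generalize (1 + r) ^ q = A at *
  generalize ((1 + r) * s) ^ q = B at *
  generalize (1 + s) ^ q = C at *
  generalize ((1 + s) * r) ^ q = D at *
  have : (A = C ∧ B = D) ∨ (A = D ∧ B = C) ∨ (C = D ∧ A = B) := by
    clear hl hl' fAB fCD fAC fBD fAD fBC hA0 hB0 hC0 hD0 hdiv hinf h h12 hr1 hs1 hr hs hrs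
    grind
  rcases this with ⟨h1, h2⟩ | ⟨h1, h2⟩ | ⟨h1, h2⟩
  · exact Or.inl ⟨fAC h1, fBD h2⟩
  · exact Or.inr (Or.inl ⟨fAD h1, fBC h2⟩)
  · exact Or.inr (Or.inr ⟨fCD h1, fAB h2⟩)
end

section
/- Let a, b, c, A, B, C ∈ ℂ all be nonzero. If the equation (1 + a·A^m)·(1 + b·B^m) + c·C^m = 0 has infinitely many solutions m ∈ ℕ, then A, B, and C are all roots of unity. -/
open Polynomial
open scoped Cardinal


theorem aux_poly (a b c α β γ : ℂ)
    (h : ∀ k : ℕ, (1 + a * α ^ k) * (1 + b * β ^ k) + c * γ ^ k = 0) (P : ℂ[X]) :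
    P.eval 1 + a * P.eval α + b * P.eval β + a * b * P.eval (α * β) + c * P.eval γ = 0 := by
  induction P using Polynomial.induction_on' with
  | add p q hp hq => simp only [eval_add]; linear_combination hp + hq
  | monomial n r => 
    simp only [eval_monomial]
    have := h n
    rw [mul_pow]
    linear_combination r * this

theorem aux_one (a b c β γ : ℂ) (hb : b ≠ 0) (hc : c ≠ 0)
    (h : ∀ k : ℕ, (1 + a * 1 ^ k) * (1 + b * β ^ k) + c * γ ^ k = 0) : β = 1 ∧ γ = 1 := by
  have hP := aux_poly a b c 1 β γ h
  have ha : 1 + a ≠ 0 := by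
    intro h0
    have := h 0
    simp [h0] at this
    exact hc this
  have h1 : β = 1 := by
    by_contra hβ
    have e1 := hP ((X - C 1) * (X - C γ))
    simp at e1
    have e2 : b * (1 + a) * ((β - 1) * (β - γ)) = 0 := by linear_combination e1
    have e3 : β = γ := by
      have : β - 1 ≠ 0 := sub_ne_zero.2 hβ
      simpa [hb, ha, this, sub_eq_zero] using e2
    subst e3
    have e4 := hP (X - C β)
    simp at e4
    have e5 : (1 + a) * (1 - β) = 0 := by linear_combination e4
    rcases mul_eq_zero.1 e5 with h' | h'
    · exact ha h'
    · exact hβ (sub_eq_zero.1 h').symm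
  refine ⟨h1, ?_⟩
  subst h1
  have e4 := hP (X - C 1)
  simpa [hc, sub_eq_zero] using e4

theorem aux_final (a b c α β γ : ℂ) (ha : a ≠ 0) (hb : b ≠ 0) (hc : c ≠ 0)
    (hα : α ≠ 0) (hβ : β ≠ 0)
    (h : ∀ k : ℕ, (1 + a * α ^ k) * (1 + b * β ^ k) + c * γ ^ k = 0) :
    α ^ 2 = 1 ∧ β ^ 2 = 1 ∧ γ ^ 2 = 1 := by
  by_cases h1 : α = 1
  · subst h1
    obtain ⟨rfl, rfl⟩ := aux_one a b c β γ hb hc h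
    simp
  by_cases h2 : β = 1
  · subst h2
    obtain ⟨rfl, rfl⟩ := aux_one b a c α γ ha hc (fun k => by rw [← h k]; ring)
    simp
  have hP := aux_poly a b c α β γ h
  have h1' : α - 1 ≠ 0 := sub_ne_zero.2 h1
  have h2' : β - 1 ≠ 0 := sub_ne_zero.2 h2
  by_cases h3 : α = β
  · subst h3
    have hs : α ^ 2 = 1 := by
      by_contra h4
      have h4' : α * α - 1 ≠ 0 := by rw [← sq]; exact sub_ne_zero.2 h4
      have h5' : α * α - α ≠ 0 := by
        have : α * α - α = α * (α - 1) := by ring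
        rw [this]; exact mul_ne_zero hα h1'
      have e1 := hP ((X - C 1) * (X - C α) * (X - C γ))
      simp [ha, hb, h4', h5', sub_eq_zero] at e1
      have e1 : α * α = γ := by
        by_contra h6
        simp_all [sub_eq_zero]
      subst e1
      have e2 := hP ((X - C α) * (X - C (α * α)))
      simp at e2
      rcases e2 with h' | h'
      · exact h1' (by linear_combination -h')
      · exact h4' (by linear_combination -h')
    refine ⟨hs, hs, ?_⟩
    have e1 := hP ((X - C 1) * (X - C α))
    have hs' : α * α = 1 := by rw [← sq]; exact hs
    simp [hs', hc, sub_eq_zero] at e1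
    rcases e1 with rfl | rfl
    · simp
    · exact hs
  · exfalso
    have h3' : α - β ≠ 0 := sub_ne_zero.2 h3
    have h4 : α - α * β ≠ 0 := by
      have : α - α * β = - (α * (β - 1)) := by ring
      rw [this]; exact neg_ne_zero.2 (mul_ne_zero hα h2')
    have h5 : β - α * β ≠ 0 := by
      have : β - α * β = - (β * (α - 1)) := by ring
      rw [this]; exact neg_ne_zero.2 (mul_ne_zero hβ h1')
    have e1 := hP ((X - C 1) * (X - C (α * β)) * (X - C β) * (X - C γ))
    have e2 := hP ((X - C 1) * (X - C (α * β)) * (X - C α) * (X - C γ))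
    simp only [eval_mul, eval_sub, eval_X, eval_C, sub_self, mul_zero, zero_mul, add_zero, zero_add,
      mul_eq_zero, ha, hb, h1', h2', h3', h4, h5, false_or, or_false] at e1 e2
    have h6 : β - α ≠ 0 := sub_ne_zero.2 (Ne.symm h3)
    simp only [h6, false_or] at e2
    exact h3 (by linear_combination e1 - e2)


theorem quot_bound {K : Type*} [NormedField K] [IsUltrametricDist K] (Q : K[X]) (x : K)
    (hx : ‖x‖ ≤ 1) (E : ℕ → ℝ) (hE : Antitone E) (hE0 : ∀ n, 0 ≤ E n)
    (h : ∀ n, ‖((X - C x) * Q).coeff n‖ ≤ E n) (n : ℕ) : ‖Q.coeff n‖ ≤ E (n + 1) := by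
  by_cases hn : Q.natDegree < n
  · rw [coeff_eq_zero_of_natDegree_lt hn]; simpa using hE0 _
  · have ih := quot_bound Q x hx E hE hE0 h (n + 1)
    have e : Q.coeff n = ((X - C x) * Q).coeff (n + 1) + x * Q.coeff (n + 1) := by
      simp [sub_mul, coeff_X_mul, coeff_C_mul]
    rw [e]
    refine (IsUltrametricDist.norm_add_le_max _ _).trans (max_le (h _) ?_)
    rw [norm_mul]
    calc ‖x‖ * ‖Q.coeff (n + 1)‖ ≤ 1 * ‖Q.coeff (n + 1)‖ := by gcongr
      _ ≤ E (n + 1 + 1) := by simpa using ih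
      _ ≤ E (n + 1) := hE (by omega)
termination_by Q.natDegree + 1 - n

theorem eval_bound {K : Type*} [NormedField K] [IsUltrametricDist K] (P : K[X]) (x : K)
    (hx : ‖x‖ ≤ 1) (M : ℝ) (hM : 0 ≤ M) (h : ∀ n, ‖P.coeff n‖ ≤ M) : ‖P.eval x‖ ≤ M := by
  rw [eval_eq_sum_range]
  refine IsUltrametricDist.norm_sum_le_of_forall_le_of_nonneg hM fun i _ => ?_
  rw [norm_mul, norm_pow]
  calc _ ≤ M * 1 := by
        gcongr
        · exact h i
        · exact pow_le_one₀ (norm_nonneg _) hx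
    _ = M := mul_one M

theorem strassmann {K : Type*} [NormedField K] [IsUltrametricDist K] [CharZero K] (Z : Finset ℕ) :
    ∀ (P : K[X]) (E : ℕ → ℝ), Antitone E → (∀ n, 0 ≤ E n) → (∀ n, ‖P.coeff n‖ ≤ E n) →
    (∀ z ∈ Z, P.eval (z : K) = 0) → ∀ k : ℕ, ‖P.eval (k : K)‖ ≤ E Z.card := by
  induction Z using Finset.induction_on with
  | empty =>
    intro P E hE hE0 h _ k
    exact eval_bound P k (IsUltrametricDist.norm_natCast_le_one K k) _ (hE0 _)
      fun n => (h n).trans (hE (by simp))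
  | insert z Z hz ih =>
    intro P E hE hE0 h hroot k
    obtain ⟨Q, rfl⟩ := dvd_iff_isRoot.2 (hroot z (Finset.mem_insert_self _ _))
    have hq := quot_bound Q z (IsUltrametricDist.norm_natCast_le_one K z) E hE hE0 h
    have := ih Q (fun n => E (n + 1)) (fun a b hab => hE (by omega)) (fun n => hE0 _) hq ?_ k
    · rw [Finset.card_insert_of_notMem hz, eval_mul, norm_mul]
      refine le_trans ?_ this
      have : ‖eval (k : K) (X - C (z : K))‖ ≤ 1 := by
        have := IsUltrametricDist.norm_intCast_le_one K ((k : ℤ) - z)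
        simpa using this
      calc _ ≤ 1 * ‖eval (k : K) Q‖ := by gcongr
        _ = _ := one_mul _
    · intro y hy
      have h1 := hroot y (Finset.mem_insert_of_mem hy)
      rw [eval_mul, mul_eq_zero] at h1
      refine h1.resolve_left ?_
      simp only [eval_sub, eval_X, eval_C, sub_eq_zero, Nat.cast_inj]
      rintro rfl; exact hz hy

theorem skolem {K : Type*} [NormedField K] [IsUltrametricDist K] [CharZero K]
    (δ ρ : ℝ) (hδ : 0 ≤ δ) (hρ0 : 0 ≤ ρ) (hρ : ρ < 1)
    (hfac : ∀ j : ℕ, δ ^ j ≤ ρ ^ j * ‖((j.factorial : ℕ) : K)‖)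
    {ι : Type*} [Fintype ι] (α μ : ι → K) (hμ : ∀ i, ‖μ i - 1‖ ≤ δ)
    (hinf : {k : ℕ | ∑ i, α i * μ i ^ k = 0}.Infinite) (k : ℕ) : ∑ i, α i * μ i ^ k = 0 := by
  set M : ℝ := ∑ i, ‖α i‖ with hM
  have hM0 : 0 ≤ M := Finset.sum_nonneg fun i _ => norm_nonneg _
  let v : ℕ → K := fun j => ∑ i, α i * (μ i - 1) ^ j
  let c : ℕ → K := fun j => v j / (j.factorial : ℕ)
  have hfne : ∀ j : ℕ, ((j.factorial : ℕ) : K) ≠ 0 := fun j =>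
    Nat.cast_ne_zero.2 j.factorial_ne_zero
  have hc : ∀ j, ‖c j‖ ≤ M * ρ ^ j := by
    intro j
    have : ‖v j‖ ≤ M * δ ^ j := by
      refine IsUltrametricDist.norm_sum_le_of_forall_le_of_nonneg (by positivity) fun i _ => ?_
      rw [norm_mul, norm_pow]
      gcongr
      · exact Finset.single_le_sum (f := fun i => ‖α i‖) (fun i _ => norm_nonneg _) (Finset.mem_univ i)
      · exact hμ i
    rw [norm_div, div_le_iff₀ (norm_pos_iff.2 (hfne j)), mul_assoc]
    exact this.trans (by gcongr; exact hfac j)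
  let P : ℕ → K[X] := fun N => ∑ j ∈ Finset.range (N + 1),
    C (c j) * (descPochhammer ℤ j).map (Int.castRingHom K)
  have hP1 : ∀ N n, ‖(P N).coeff n‖ ≤ M * ρ ^ n := by
    intro N n
    simp only [P, finsetSum_coeff, coeff_C_mul]
    refine IsUltrametricDist.norm_sum_le_of_forall_le_of_nonneg (by positivity) fun j _ => ?_
    by_cases hj : j < n
    · rw [coeff_map, coeff_eq_zero_of_natDegree_lt]
      · simp; positivity
      · rwa [descPochhammer_natDegree]
    · rw [norm_mul, coeff_map]
      calc _ ≤ (M * ρ ^ j) * 1 := by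
            gcongr
            · exact hc j
            · simpa using IsUltrametricDist.norm_intCast_le_one K _
        _ = M * ρ ^ j := mul_one _
        _ ≤ M * ρ ^ n := by
            gcongr M * ?_
            exact pow_le_pow_of_le_one hρ0 hρ.le (by omega)
  have hP2 : ∀ N k, k ≤ N → (P N).eval (k : K) = ∑ i, α i * μ i ^ k := by
    intro N k hk
    have e1 : ∀ j, (C (c j) * (descPochhammer ℤ j).map (Int.castRingHom K)).eval (k : K)
        = (k.choose j : K) * v j := by
      intro j
      rw [eval_mul, eval_C, descPochhammer_map, descPochhammer_eval_eq_descFactorial,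
        Nat.descFactorial_eq_factorial_mul_choose]
      simp only [c]
      have := hfne j
      push_cast
      field_simp
    simp only [P, eval_finsetSum, e1]
    have e2 : ∀ i, μ i ^ k = ∑ j ∈ Finset.range (N + 1), (k.choose j : K) * (μ i - 1) ^ j := by
      intro i
      conv_lhs => rw [← sub_add_cancel (μ i) 1, add_pow]
      simp only [one_pow, mul_one]
      rw [← Finset.sum_subset (Finset.range_subset_range.2 (Nat.add_le_add_right hk 1))]
      · exact Finset.sum_congr rfl fun j _ => mul_comm _ _
      · intro j _ hj
        rw [Nat.choose_eq_zero_of_lt (by simpa using hj)]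
        simp
    simp only [e2, v, Finset.mul_sum]
    rw [Finset.sum_comm]
    exact Finset.sum_congr rfl fun i _ => Finset.sum_congr rfl fun j _ => by ring
  have key : ∀ n, ‖∑ i, α i * μ i ^ k‖ ≤ M * ρ ^ n := by
    intro n
    obtain ⟨Z, hZ, hZc⟩ := hinf.exists_subset_card_eq n
    have hN : ∀ z ∈ insert k Z, z ≤ (insert k Z).sup id := fun z hz =>
      Finset.le_sup (f := id) hz
    set N := (insert k Z).sup id
    have := strassmann Z (P N) (fun n => M * ρ ^ n)
      (fun a b hab => by
        dsimp only
        gcongr M * ?_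
        exact pow_le_pow_of_le_one hρ0 hρ.le hab)
      (fun n => by positivity) (hP1 N)
      (fun z hz => by
        rw [hP2 N z (hN z (Finset.mem_insert_of_mem hz))]
        exact hZ hz) k
    rwa [hP2 N k (hN k (Finset.mem_insert_self _ _)), hZc] at this
  have hlim : Filter.Tendsto (fun n : ℕ => M * ρ ^ n) Filter.atTop (nhds 0) := by
    simpa using (tendsto_pow_atTop_nhds_zero_of_lt_one hρ0 hρ).const_mul M
  exact norm_le_zero_iff.1 (ge_of_tendsto' hlim key)


theorem padic_fac (p : ℕ) [Fact p.Prime] (hp : 3 ≤ p) (j : ℕ) :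
    ((p : ℝ)⁻¹) ^ j ≤ (√((p : ℝ)⁻¹)) ^ j * ‖((j.factorial : ℕ) : PadicAlgCl p)‖ := by
  have h1 : ‖((j.factorial : ℕ) : PadicAlgCl p)‖ = ((p : ℝ)⁻¹) ^ (padicValNat p j.factorial) := by
    rw [← map_natCast (algebraMap ℚ_[p] (PadicAlgCl p)), PadicAlgCl.norm_extends,
      Padic.norm_eq_zpow_neg_valuation (Nat.cast_ne_zero.2 j.factorial_ne_zero),
      Padic.valuation_natCast]
    simp
  have h2 : 2 * padicValNat p j.factorial ≤ j := by
    have := sub_one_mul_padicValNat_factorial (p := p) j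
    have h3 : 2 * padicValNat p j.factorial ≤ (p - 1) * padicValNat p j.factorial :=
      Nat.mul_le_mul_right _ (by omega)
    omega
  rw [h1]
  have hp0 : (0 : ℝ) < (p : ℝ)⁻¹ := by positivity
  have hp1 : (p : ℝ)⁻¹ ≤ 1 := inv_le_one_of_one_le₀ (by exact_mod_cast (by omega : 1 ≤ p))
  set q := (p : ℝ)⁻¹
  have hs : √q * √q = q := Real.mul_self_sqrt hp0.le
  have hs1 : √q ≤ 1 := Real.sqrt_le_one.2 hp1 
  have e1 : q ^ j = √q ^ j * √q ^ j := by rw [← mul_pow, hs]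
  have e2 : q ^ padicValNat p j.factorial = √q ^ (2 * padicValNat p j.factorial) := by
    rw [pow_mul, sq, hs]
  rw [e1, e2]
  gcongr √q ^ j * ?_
  exact pow_le_pow_of_le_one (Real.sqrt_nonneg _) hs1 h2

theorem padic_root (p : ℕ) [Fact p.Prime] (x : PadicAlgCl p) (hx : ‖x‖ = 1) :
    ∃ d : ℕ, 0 < d ∧ ‖x ^ d - 1‖ ≤ (p : ℝ)⁻¹ := by
  have hint : IsIntegral ℚ_[p] x := Algebra.IsIntegral.isIntegral x
  have hmon : (minpoly ℚ_[p] x).Monic := minpoly.monic hint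
  have hco : ∀ n, ‖(minpoly ℚ_[p] x).coeff n‖ ≤ 1 := by
    rw [← spectralValue_le_one_iff hmon]
    have := PadicAlgCl.spectralNorm_eq p x
    rw [spectralNorm] at this
    rw [this, hx]
  obtain ⟨q, hq, -, hqm⟩ := lifts_and_natDegree_eq_and_monic (f := algebraMap ℤ_[p] ℚ_[p])
    (p := minpoly ℚ_[p] x) (by
      rw [lifts_iff_coeff_lifts]
      intro n
      exact ⟨⟨_, hco n⟩, rfl⟩) hmon
  let f : ℤ_[p] →+* PadicAlgCl p := (algebraMap ℚ_[p] (PadicAlgCl p)).comp (algebraMap ℤ_[p] ℚ_[p])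
  have hf : ∀ z, ‖f z‖ = ‖z‖ := fun z => PadicAlgCl.norm_extends p _
  have hqx : q.eval₂ f x = 0 := by
    rw [← eval₂_map, hq]
    exact minpoly.aeval _ _
  have hr : ∀ n : ℕ, (X ^ n %ₘ q).eval₂ f x = x ^ n := by
    intro n
    rw [eval₂_modByMonic_eq_self_of_root hqx]
    simp
  obtain ⟨i, j, hij, he⟩ := Finite.exists_ne_map_eq_of_infinite
    (fun (n : ℕ) (i : Fin (q.natDegree + 1)) => PadicInt.toZMod ((X ^ n %ₘ q).coeff i))
  wlog hlt : i < j generalizing i j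
  · exact this j i hij.symm he.symm (by omega)
  refine ⟨j - i, by omega, ?_⟩
  have h1 : ‖x ^ j - x ^ i‖ ≤ (p : ℝ)⁻¹ := by
    rw [← hr i, ← hr j, ← eval₂_sub, ← eval_map]
    have : ∀ n, ‖((X ^ j %ₘ q - X ^ i %ₘ q).map f).coeff n‖ ≤ (p : ℝ)⁻¹ := by
      intro n
      rw [coeff_map, hf, coeff_sub]
      by_cases hn : n < q.natDegree + 1
      · have h2 := congrFun he ⟨n, hn⟩
        dsimp only at h2
        have h3 : (X ^ j %ₘ q).coeff n - (X ^ i %ₘ q).coeff n ∈ RingHom.ker (PadicInt.toZMod (p := p)) := by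
          rw [RingHom.mem_ker, map_sub, h2, sub_self]
        rw [PadicInt.ker_toZMod, PadicInt.maximalIdeal_eq_span_p] at h3
        have := (PadicInt.norm_le_pow_iff_mem_span_pow _ 1).2 (by simpa using h3)
        simpa using this
      · have hd : ∀ m : ℕ, (X ^ m %ₘ q).coeff n = 0 := fun m => by
          apply coeff_eq_zero_of_natDegree_lt
          have := natDegree_modByMonic_le (X ^ m) hqm
          omega
        simp [hd]
    rw [eval_eq_sum_range]
    refine IsUltrametricDist.norm_sum_le_of_forall_le_of_nonneg (by positivity) fun n _ => ?_
    rw [norm_mul, norm_pow, hx, one_pow, mul_one]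
    exact this n
  have h2 : x ^ j - x ^ i = x ^ i * (x ^ (j - i) - 1) := by
    rw [mul_sub, ← pow_add]; congr 2 <;> [omega; simp]
  rwa [h2, norm_mul, norm_pow, hx, one_pow, one_mul] at h1

theorem pow_close {K : Type*} [NormedField K] [IsUltrametricDist K] (x : K) (r : ℝ) (hx : ‖x‖ ≤ 1)
    (h : ‖x - 1‖ ≤ r) (n : ℕ) : ‖x ^ n - 1‖ ≤ r := by
  have h0 : 0 ≤ r := (norm_nonneg _).trans h
  have e : x ^ n - 1 = (∑ i ∈ Finset.range n, x ^ i) * (x - 1) := (geom_sum_mul x n).symm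
  rw [e, norm_mul]
  have : ‖∑ i ∈ Finset.range n, x ^ i‖ ≤ 1 := by
    refine IsUltrametricDist.norm_sum_le_of_forall_le_of_nonneg zero_le_one fun n _ => ?_
    rw [norm_pow]
    exact pow_le_one₀ (norm_nonneg _) hx
  calc _ ≤ 1 * r := by gcongr
    _ = r := one_mul r


theorem norm_le_one_of_integral {K : Type*} [NormedField K] [IsUltrametricDist K] (f : K[X])
    (hf : f.Monic) (hc : ∀ n, ‖f.coeff n‖ ≤ 1) (x : K) (hx : f.eval x = 0) : ‖x‖ ≤ 1 := by
  by_contra h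
  push Not at h
  have h1 : x ^ f.natDegree = - ∑ i ∈ Finset.range f.natDegree, f.coeff i * x ^ i := by
    rw [eval_eq_sum_range, Finset.sum_range_succ, hf.coeff_natDegree, one_mul] at hx
    linear_combination hx
  have hd : f.natDegree ≠ 0 := by
    intro h0
    rw [h0] at h1
    simp at h1
  have h2 : ‖x ^ f.natDegree‖ ≤ ‖x‖ ^ (f.natDegree - 1) := by
    rw [h1, norm_neg]
    refine IsUltrametricDist.norm_sum_le_of_forall_le_of_nonneg (by positivity) fun i hi => ?_
    rw [norm_mul, norm_pow]
    calc _ ≤ 1 * ‖x‖ ^ i := by gcongr; exact hc i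
      _ = ‖x‖ ^ i := one_mul _
      _ ≤ _ := pow_le_pow_right₀ h.le (by have := Finset.mem_range.1 hi; omega)
  rw [norm_pow] at h2
  exact absurd h2 (not_le.2 (pow_lt_pow_right₀ h (by omega)))

theorem mv_norm_le {K T : Type*} [NormedField K] [IsUltrametricDist K]
    (τ : T → K) (hτ : ∀ t, ‖τ t‖ ≤ 1) (g : MvPolynomial T ℤ) : ‖MvPolynomial.aeval τ g‖ ≤ 1 := by
  induction g using MvPolynomial.induction_on with
  | C a => simpa using IsUltrametricDist.norm_intCast_le_one K a
  | add p q hp hq =>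
    rw [map_add]
    exact (IsUltrametricDist.norm_add_le_max _ _).trans (max_le hp hq)
  | mul_X p t hp =>
    rw [map_mul, MvPolynomial.aeval_X, norm_mul]
    exact mul_le_one₀ hp (norm_nonneg _) (hτ t)

theorem mv_norm_sub_le {K T : Type*} [NormedField K] [IsUltrametricDist K] (r : ℝ) (hr : 0 ≤ r)
    (τ : T → K) (n : T → ℤ) (hτ : ∀ t, ‖τ t‖ ≤ 1) (hn : ∀ t, ‖τ t - n t‖ ≤ r)
    (g : MvPolynomial T ℤ) :
    ‖MvPolynomial.aeval τ g - ((MvPolynomial.eval n g : ℤ) : K)‖ ≤ r := by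
  induction g using MvPolynomial.induction_on with
  | C a => simpa using hr
  | add p q hp hq =>
    rw [map_add, map_add, Int.cast_add, add_sub_add_comm]
    exact (IsUltrametricDist.norm_add_le_max _ _).trans (max_le hp hq)
  | mul_X p t hp =>
    rw [map_mul, map_mul, MvPolynomial.aeval_X, MvPolynomial.eval_X, Int.cast_mul]
    have e : MvPolynomial.aeval τ p * τ t - ((MvPolynomial.eval n p : ℤ) : K) * (n t : K)
      = (MvPolynomial.aeval τ p - ((MvPolynomial.eval n p : ℤ) : K)) * τ t +
        ((MvPolynomial.eval n p : ℤ) : K) * (τ t - n t) := by ring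
    rw [e]
    refine (IsUltrametricDist.norm_add_le_max _ _).trans (max_le ?_ ?_)
    · rw [norm_mul]
      calc _ ≤ r * 1 := by gcongr; exact hτ t
        _ = r := mul_one r
    · rw [norm_mul]
      calc _ ≤ 1 * r := by
            gcongr
            · exact IsUltrametricDist.norm_intCast_le_one K _
            · exact hn t
        _ = r := one_mul r

theorem exists_indep (p : ℕ) [Fact p.Prime] (T : Type) (hT : #T ≤ 𝔠) :
    ∃ σ : T → PadicAlgCl p, AlgebraicIndependent ℤ σ := by
  obtain ⟨ι, y, hy⟩ := exists_isTranscendenceBasis' ℤ (PadicAlgCl p)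
  have h1 : 𝔠 ≤ #(PadicAlgCl p) := (continuum_le_cardinal_of_nontriviallyNormedField ℚ_[p]).trans
    (Cardinal.mk_le_of_injective (algebraMap ℚ_[p] (PadicAlgCl p)).injective)
  have h2 := IsAlgClosed.cardinal_eq_cardinal_transcendence_basis_of_aleph0_lt' y hy
    (by simp) (Cardinal.aleph0_lt_continuum.trans_le h1)
  rw [h2] at h1
  obtain ⟨e⟩ := Cardinal.le_def _ _ |>.1 (hT.trans h1)
  exact ⟨y ∘ e, hy.1.comp e e.injective⟩

theorem exists_small (p : ℕ) [Fact p.Prime] (T : Type) (hT : #T ≤ 𝔠) (n : T → ℤ) :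
    ∃ τ : T → PadicAlgCl p, AlgebraicIndependent ℤ τ ∧ ∀ t, ‖τ t - n t‖ ≤ (p : ℝ)⁻¹ := by
  obtain ⟨σ, hσ⟩ := exists_indep p T hT
  have hp0 : (0 : ℝ) < (p : ℝ)⁻¹ := by
    have := (Fact.out : p.Prime).pos
    positivity
  have hp1 : (p : ℝ)⁻¹ < 1 := inv_lt_one_of_one_lt₀ (by exact_mod_cast (Fact.out : p.Prime).one_lt)
  have hpn : ‖(p : PadicAlgCl p)‖ = (p : ℝ)⁻¹ := by
    rw [← map_natCast (algebraMap ℚ_[p] (PadicAlgCl p)), PadicAlgCl.norm_extends, Padic.norm_p]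
  have hN : ∀ t, ∃ N : ℕ, ‖σ t‖ * (p : ℝ)⁻¹ ^ N ≤ (p : ℝ)⁻¹ := by
    intro t
    have hlim : Filter.Tendsto (fun n : ℕ => ‖σ t‖ * (p : ℝ)⁻¹ ^ n) Filter.atTop (nhds 0) := by
      simpa using (tendsto_pow_atTop_nhds_zero_of_lt_one hp0.le hp1).const_mul ‖σ t‖
    exact (hlim.eventually_le_const hp0).exists
  choose N hN using hN
  refine ⟨_, hσ.polynomial_aeval_of_transcendental
    (f := fun t => C ((p : ℤ) ^ N t) * X + C (n t)) fun t => ?_, fun t => ?_⟩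
  · have hpz : (p : ℤ) ^ N t ≠ 0 := pow_ne_zero _ (by exact_mod_cast (Fact.out : p.Prime).ne_zero)
    refine Polynomial.transcendental _ ?_ ?_
    · rw [natDegree_linear hpz]; exact one_ne_zero
    · rw [leadingCoeff_linear hpz]; exact mem_nonZeroDivisors_of_ne_zero hpz
  · simp [hpn]
    rw [mul_comm]
    simpa using hN t

theorem embed (s : Finset ℂ) : ∃ (p : ℕ) (_ : Fact p.Prime) (φ : ℂ →+* PadicAlgCl p), 3 ≤ p ∧
    ∀ x ∈ s, ‖φ x‖ ≤ 1 := by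
  obtain ⟨T, x, hx⟩ := exists_isTranscendenceBasis' ℤ ℂ
  have hT : #T ≤ 𝔠 := by
    rw [← Cardinal.mk_complex]
    exact Cardinal.mk_le_of_injective hx.1.injective
  let : Algebra (MvPolynomial T ℤ) ℂ := (MvPolynomial.aeval x).toRingHom.toAlgebra
  have hinj : Function.Injective (algebraMap (MvPolynomial T ℤ) ℂ) := hx.1
  have : FaithfulSMul (MvPolynomial T ℤ) ℂ := (faithfulSMul_iff_algebraMap_injective _ _).2 hinj
  have : Algebra.IsAlgebraic (MvPolynomial T ℤ) ℂ := by
    have := hx.isAlgebraic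
    refine Algebra.IsAlgebraic.of_ringHom_of_comp_eq hx.1.aevalEquiv.toRingEquiv.toRingHom
      (RingHom.id ℂ) hx.1.aevalEquiv.surjective Function.injective_id ?_
    refine RingHom.ext fun g => ?_
    exact hx.1.algebraMap_aevalEquiv g
  obtain ⟨f, hf0, hf⟩ := Algebra.IsAlgebraic.exists_integral_multiples (MvPolynomial T ℤ) s
  obtain ⟨n, hn⟩ : ∃ n : T → ℤ, MvPolynomial.eval n f ≠ 0 := by
    by_contra h
    push Not at h
    exact hf0 (MvPolynomial.funext fun n => by simpa using h n)
  obtain ⟨p, hp, hpp⟩ := Nat.exists_infinite_primes ((MvPolynomial.eval n f).natAbs + 3)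
  have : Fact p.Prime := ⟨hpp⟩
  obtain ⟨τ, hτ, hτn⟩ := exists_small p T hT n
  have hp1 : (p : ℝ)⁻¹ < 1 := inv_lt_one_of_one_lt₀ (by exact_mod_cast hpp.one_lt)
  have hτ1 : ∀ t, ‖τ t‖ ≤ 1 := by
    intro t
    have : τ t = (τ t - n t) + n t := by ring
    rw [this]
    exact (IsUltrametricDist.norm_add_le_max _ _).trans (max_le ((hτn t).trans hp1.le)
      (IsUltrametricDist.norm_intCast_le_one _ _))
  have hfn : ‖((MvPolynomial.eval n f : ℤ) : PadicAlgCl p)‖ = 1 := by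
    rw [← map_intCast (algebraMap ℚ_[p] (PadicAlgCl p)), PadicAlgCl.norm_extends]
    refine le_antisymm (Padic.norm_int_le_one _) (not_lt.1 fun h => ?_)
    rw [Padic.norm_intCast_lt_one_iff] at h
    have := Int.natAbs_dvd_natAbs.2 h
    have := Nat.le_of_dvd (Int.natAbs_pos.2 hn) this
    simp at this
    omega
  have hfτ : ‖MvPolynomial.aeval τ f‖ = 1 := by
    refine le_antisymm (mv_norm_le τ hτ1 f) (not_lt.1 fun h => ?_)
    have h1 := mv_norm_sub_le _ (by positivity) τ n hτ1 hτn f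
    have e : ((MvPolynomial.eval n f : ℤ) : PadicAlgCl p) = MvPolynomial.aeval τ f -
      (MvPolynomial.aeval τ f - ((MvPolynomial.eval n f : ℤ) : PadicAlgCl p)) := by ring
    have h2 : ‖((MvPolynomial.eval n f : ℤ) : PadicAlgCl p)‖ < 1 := by
      rw [e]
      rw [sub_eq_add_neg]
      refine (IsUltrametricDist.norm_add_le_max _ _).trans_lt ?_
      rw [norm_neg]
      exact (max_lt h (h1.trans_lt hp1))
    exact absurd hfn h2.ne
  let : Algebra (MvPolynomial T ℤ) (PadicAlgCl p) := (MvPolynomial.aeval τ).toRingHom.toAlgebra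
  have hinj' : Function.Injective (algebraMap (MvPolynomial T ℤ) (PadicAlgCl p)) := hτ
  have : FaithfulSMul (MvPolynomial T ℤ) (PadicAlgCl p) :=
    (faithfulSMul_iff_algebraMap_injective _ _).2 hinj'
  let φ : ℂ →ₐ[MvPolynomial T ℤ] PadicAlgCl p := IsAlgClosed.lift
  refine ⟨p, inferInstance, φ.toRingHom, by omega, fun y hy => ?_⟩
  have hint := (hf y hy).map φ
  rw [Algebra.smul_def, map_mul, φ.commutes] at hint
  obtain ⟨g, hg, hgx⟩ := hint
  have h1 : ‖(algebraMap (MvPolynomial T ℤ) (PadicAlgCl p)) f * φ y‖ ≤ 1 := by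
    refine norm_le_one_of_integral (g.map (algebraMap _ _)) (hg.map _) (fun n => ?_) _
      (by rw [eval_map]; exact hgx)
    rw [coeff_map]
    exact mv_norm_le τ hτ1 _
  rw [norm_mul] at h1
  have h2 : ‖(algebraMap (MvPolynomial T ℤ) (PadicAlgCl p)) f‖ = 1 := hfτ
  rw [h2, one_mul] at h1
  exact h1


theorem pigeon (S : Set ℕ) (hS : S.Infinite) (d : ℕ) (hd : 0 < d) :
    ∃ r, {k : ℕ | r + d * k ∈ S}.Infinite := by
  by_contra h
  push Not at h
  refine hS (Set.Finite.subset (Set.Finite.biUnion (Finset.range d).finite_toSet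
    (fun r _ => (h r).image (fun k => r + d * k))) ?_)
  intro m hm
  simp only [Set.mem_iUnion]
  refine ⟨m % d, by simpa using Nat.mod_lt m hd, m / d, ?_, Nat.mod_add_div m d⟩
  simpa [Nat.mod_add_div] using hm

theorem abc_diophantine (a b c A B C : ℂ)
    (ha : a ≠ 0) (hb : b ≠ 0) (hc : c ≠ 0)
    (hA : A ≠ 0) (hB : B ≠ 0) (hC : C ≠ 0)
    (hinf : {m : ℕ | (1 + a * A ^ m) * (1 + b * B ^ m) + c * C ^ m = 0}.Infinite) :
    IsRootOfUnity A ∧ IsRootOfUnity B ∧ IsRootOfUnity C := by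
  classical
  obtain ⟨p, hpF, φ, hp3, hφ⟩ := embed {A, B, C, A⁻¹, B⁻¹, C⁻¹}
  have hunit : ∀ x : ℂ, x ≠ 0 → ‖φ x‖ ≤ 1 → ‖φ x⁻¹‖ ≤ 1 → ‖φ x‖ = 1 := by
    intro x hx h1 h2
    refine le_antisymm h1 ?_
    have hpos : 0 < ‖φ x‖ := norm_pos_iff.2 ((map_ne_zero φ).2 hx)
    rw [map_inv₀, norm_inv] at h2
    exact (inv_le_one₀ hpos).1 h2
  have nA := hunit A hA (hφ _ (by simp)) (hφ _ (by simp))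
  have nB := hunit B hB (hφ _ (by simp)) (hφ _ (by simp))
  have nC := hunit C hC (hφ _ (by simp)) (hφ _ (by simp))
  obtain ⟨d₁, hd₁, h₁⟩ := padic_root p _ nA
  obtain ⟨d₂, hd₂, h₂⟩ := padic_root p _ nB
  obtain ⟨d₃, hd₃, h₃⟩ := padic_root p _ nC
  obtain ⟨d, hd⟩ : ∃ d, d = d₁ * d₂ * d₃ := ⟨_, rfl⟩
  have hd0 : 0 < d := by rw [hd]; positivity
  have cA : ‖φ A ^ d - 1‖ ≤ (p : ℝ)⁻¹ := by
    rw [hd, mul_assoc, pow_mul]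
    exact pow_close _ _ (by rw [norm_pow, nA, one_pow]) h₁ _
  have cB : ‖φ B ^ d - 1‖ ≤ (p : ℝ)⁻¹ := by
    rw [hd, mul_comm d₁, mul_assoc, pow_mul]
    exact pow_close _ _ (by rw [norm_pow, nB, one_pow]) h₂ _
  have cC : ‖φ C ^ d - 1‖ ≤ (p : ℝ)⁻¹ := by
    rw [hd, mul_comm _ d₃, pow_mul]
    exact pow_close _ _ (by rw [norm_pow, nC, one_pow]) h₃ _
  have cAB : ‖φ A ^ d * φ B ^ d - 1‖ ≤ (p : ℝ)⁻¹ := by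
    have e : φ A ^ d * φ B ^ d - 1 = φ A ^ d * (φ B ^ d - 1) + (φ A ^ d - 1) := by ring
    rw [e]
    refine (IsUltrametricDist.norm_add_le_max _ _).trans (max_le ?_ cA)
    rwa [norm_mul, norm_pow, nA, one_pow, one_mul]
  obtain ⟨r, hr⟩ := pigeon _ hinf d hd0
  have hp1 : (p : ℝ)⁻¹ < 1 := inv_lt_one_of_one_lt₀ (by exact_mod_cast (by omega : 1 < p))
  have hp0 : (0 : ℝ) ≤ (p : ℝ)⁻¹ := by positivity
  have hsum : ∀ k : ℕ, ∑ i, (![1, φ (a * A ^ r), φ (b * B ^ r), φ (a * A ^ r * (b * B ^ r)),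
      φ (c * C ^ r)] : Fin 5 → PadicAlgCl p) i *
      (![1, φ A ^ d, φ B ^ d, φ A ^ d * φ B ^ d, φ C ^ d] : Fin 5 → PadicAlgCl p) i ^ k
      = φ ((1 + a * A ^ r * (A ^ d) ^ k) * (1 + b * B ^ r * (B ^ d) ^ k)
        + c * C ^ r * (C ^ d) ^ k) := by
    intro k
    simp only [Fin.sum_univ_five]
    simp only [Matrix.cons_val, map_add, map_mul, map_pow, map_one]
    ring
  have hsk := skolem (K := PadicAlgCl p) (p : ℝ)⁻¹ (√((p : ℝ)⁻¹)) hp0 (Real.sqrt_nonneg _)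
    ((Real.sqrt_lt' one_pos).2 (by simpa using hp1)) (padic_fac p hp3)
    ![1, φ (a * A ^ r), φ (b * B ^ r), φ (a * A ^ r * (b * B ^ r)), φ (c * C ^ r)]
    ![1, φ A ^ d, φ B ^ d, φ A ^ d * φ B ^ d, φ C ^ d]
    (by
      intro i
      fin_cases i
      · simp
      · exact cA
      · exact cB
      · exact cAB
      · exact cC)
    (by
      refine hr.mono ?_
      intro k hk
      simp only [Set.mem_ofPred_eq] at hk ⊢
      rw [hsum, map_eq_zero, ← hk]
      simp only [pow_add, pow_mul]
      ring)
  have hall : ∀ k : ℕ, (1 + a * A ^ r * (A ^ d) ^ k) * (1 + b * B ^ r * (B ^ d) ^ k)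
        + c * C ^ r * (C ^ d) ^ k = 0 := by
    intro k
    have := hsk k
    rwa [hsum, map_eq_zero] at this
  obtain ⟨e1, e2, e3⟩ := aux_final _ _ _ _ _ _ (mul_ne_zero ha (pow_ne_zero r hA))
    (mul_ne_zero hb (pow_ne_zero r hB)) (mul_ne_zero hc (pow_ne_zero r hC))
    (pow_ne_zero d hA) (pow_ne_zero d hB) hall
  rw [← pow_mul] at e1 e2 e3
  exact ⟨⟨d * 2, by omega, e1⟩, ⟨d * 2, by omega, e2⟩, ⟨d * 2, by omega, e3⟩⟩
end

section
/- Let r, s ∈ ℂ satisfy r·s·(1+r)·(1+s) ≠ 0. If the equation (1 + r^m)·(1 + s^m) = ((1 + r)·(1 + s))^m has infinitely many solutions m ∈ ℕ, then r, s, and (1+r)·(1+s) are all roots of unity. -/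
lemma U3_alg {K : Type*} [Field K] (a b c R S T : K) (ha : a ≠ 0) (hb : b ≠ 0) (hc : c ≠ 0)
    (hR0 : R ≠ 0) (hS0 : S ≠ 0)
    (h : ∀ j : ℕ, (1 + a * R ^ j) * (1 + b * S ^ j) = c * T ^ j) :
    R ^ 2 = 1 ∧ S ^ 2 = 1 ∧ T ^ 2 = 1 := by
  have hP : ∀ P : Polynomial K, P.eval 1 + a * P.eval R + b * P.eval S + a * b * P.eval (R * S)
      = c * P.eval T := by
    intro P
    induction P using Polynomial.induction_on' with
    | add p q hp hq => simp only [Polynomial.eval_add]; linear_combination hp + hq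
    | monomial n k =>
      simp only [Polynomial.eval_monomial, one_pow, mul_one, mul_pow]
      linear_combination k * h n
  have h4 : ∀ w x y z : K, (1-w)*(1-x)*(1-y)*(1-z) + a * ((R-w)*(R-x)*(R-y)*(R-z))
      + b * ((S-w)*(S-x)*(S-y)*(S-z)) + a * b * ((R*S-w)*(R*S-x)*(R*S-y)*(R*S-z))
      = c * ((T-w)*(T-x)*(T-y)*(T-z)) := by
    intro w x y z
    have := hP ((.X - .C w) * (.X - .C x) * (.X - .C y) * (.X - .C z))
    simpa using this
  have h0 : (1 + a) * (1 + b) ≠ 0 := by have := h 0; simp at this; rw [this]; exact hc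
  have ha1 : 1 + a ≠ 0 := left_ne_zero_of_mul h0
  have hb1 : 1 + b ≠ 0 := right_ne_zero_of_mul h0
  have hT : (T - 1) * (T - R) * (T - S) * (T - R * S) = 0 := by
    clear h hP
    have := h4 1 R S (R * S)
    have h' : c * ((T - 1) * (T - R) * (T - S) * (T - R * S)) = 0 := by
      rw [← this]; ring
    exact (mul_eq_zero.mp h').resolve_left hc
  by_cases hR : R = 1
  · subst hR
    by_cases hS : S = 1
    · subst hS
      have : T = 1 := by grind
      simp [this]
    · exfalso
      have e1 : (1 + a) * ((1 - S) * (1 - T)) = 0 := by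
        linear_combination h4 S T 0 0
      have e2 : (1 + a) * b * ((S - 1) ^ 2 * (S - T) ^ 2) = 0 := by
        linear_combination h4 1 1 T T
      have e3 : T = 1 := by grind
      subst e3
      simp [ha1, hb, sub_eq_zero, hS] at e2
  by_cases hS : S = 1
  · subst hS
    exfalso
    have e1 : (1 + b) * ((1 - R) * (1 - T)) = 0 := by
      linear_combination h4 R T 0 0
    have e2 : (1 + b) * a * ((R - 1) ^ 2 * (R - T) ^ 2) = 0 := by
      linear_combination h4 1 1 T T
    have e3 : T = 1 := by grind
    subst e3
    simp [hb1, ha, sub_eq_zero, hR] at e2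
  have e1 : (1 - R) * (1 - S) * (1 - T) * (1 - R * S) = 0 := by
    linear_combination h4 R S T (R * S)
  have e2 : a * ((R - 1) * (R - S) * (R - T) * (R - R * S)) = 0 := by
    linear_combination h4 1 S T (R * S)
  have e3 : b * ((S - 1) * (S - R) * (S - T) * (S - R * S)) = 0 := by
    linear_combination h4 1 R T (R * S)
  have e4 : a * b * ((R * S - 1) * (R * S - R) * (R * S - S) * (R * S - T)) = 0 := by
    linear_combination h4 1 R S T
  have n1 : R - R * S ≠ 0 := by
    intro h; apply hS; apply mul_left_cancel₀ hR0; linear_combination -h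
  have n2 : S - R * S ≠ 0 := by
    intro h; apply hR; apply mul_left_cancel₀ hS0; linear_combination -h
  have n3 : R * S - R ≠ 0 := fun h => n1 (by linear_combination -h)
  have n4 : R * S - S ≠ 0 := fun h => n2 (by linear_combination -h)
  have f1 : T = 1 ∨ R * S = 1 := by grind
  have f2 : R = S ∨ R = T := by
    simp only [mul_eq_zero, ha, n1, hR, or_false, false_or, sub_eq_zero (b := S),
      sub_eq_zero (b := T), sub_eq_zero (b := (1 : K))] at e2
    exact e2
  have f3 : R = S ∨ S = T := by
    simp only [mul_eq_zero, hb, n2, hS, or_false, false_or, sub_eq_zero (b := R),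
      sub_eq_zero (b := T), sub_eq_zero (b := (1 : K))] at e3
    exact e3.imp_left Eq.symm
  have f4 : R * S = 1 ∨ R * S = T := by
    simp only [mul_eq_zero, ha, hb, n3, n4, or_false, false_or, sub_eq_zero (b := T),
      sub_eq_zero (b := (1 : K))] at e4
    exact e4
  have hRS : R * S = 1 := by
    rcases f4 with h | h
    · exact h
    · rcases f1 with h' | h'
      · rw [h, h']
      · exact h'
  have hRS' : R = S := by
    rcases f2 with h | h
    · exact h
    · rcases f3 with h' | h'
      · exact h'
      · rw [h, h']
  subst hRS'
  have hR2 : R ^ 2 = 1 := by rw [sq]; exact hRS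
  refine ⟨hR2, hR2, ?_⟩
  have : T = 1 ∨ T = R := by grind
  rcases this with h | h
  · simp [h]
  · rw [h, hR2]
open NormedSpace in
lemma U3_radius (p : ℕ) [hp : Fact p.Prime] (K : Type*) [NontriviallyNormedField K] 
    [NormedAlgebra ℚ_[p] K] : 0 < (expSeries K K).radius := by
  have hp0 : (0:ℝ) < p := by exact_mod_cast hp.1.pos
  refine lt_of_lt_of_le ?_ (FormalMultilinearSeries.le_radius_of_bound _ 1 (r := (p:NNReal)⁻¹) ?_)
  · simp
  intro n
  have h1 : ‖expSeries K K n‖ ≤ (p:ℝ)^n := by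
    have : ‖expSeries K K n‖ = ‖((n.factorial : ℚ_[p]))‖⁻¹ := by
      rw [expSeries, norm_smul, ContinuousMultilinearMap.norm_mkPiAlgebraFin, mul_one, norm_inv,
        ← norm_algebraMap' K ((n.factorial : ℚ_[p])), map_natCast]
    rw [this, Padic.norm_eq_zpow_neg_valuation (by exact_mod_cast n.factorial_ne_zero)]
    rw [zpow_neg, inv_inv, Padic.valuation_natCast, zpow_natCast]
    apply pow_le_pow_right₀
    · exact_mod_cast hp.1.one_lt.le
    · have := sub_one_mul_padicValNat_factorial (p := p) n
      have h2 := hp.1.two_le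
      calc padicValNat p n.factorial ≤ (p-1) * padicValNat p n.factorial := 
            Nat.le_mul_of_pos_left _ (by omega)
        _ ≤ n := by omega
  simp only [NNReal.coe_inv, NNReal.coe_natCast, inv_pow]
  rw [← div_eq_mul_inv, div_le_one (by positivity)]
  exact h1

open NormedSpace in
lemma U3_exp {p : ℕ} [hp : Fact p.Prime] {K : Type*} [NontriviallyNormedField K] [CharZero K]
    [CompleteSpace K] [IsUltrametricDist K]
    [NormedAlgebra ℚ_[p] K] : ∃ δ > 0, ∀ u : K, ‖u - 1‖ < δ → ∃ F : K → K, 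
      (∀ z, ‖z‖ ≤ 1 → AnalyticAt K F z) ∧ ∀ k : ℕ, F k = u ^ k := by
  have hrad := U3_radius p K
  have hd := hasStrictDerivAt_exp_zero_of_radius_pos hrad
  have hm := hd.map_nhds_eq (by simp)
  rw [exp_zero] at hm
  have hball : Metric.eball (0 : K) (expSeries K K).radius ∈ nhds (0:K) := 
    Metric.eball_mem_nhds _ hrad
  have := Filter.image_mem_map (m := (exp : K → K)) hball
  rw [hm, Metric.mem_nhds_iff] at this
  obtain ⟨δ, hδ, hsub⟩ := this
  refine ⟨δ, hδ, fun u hu => ?_⟩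
  obtain ⟨l, hl, hlu⟩ := hsub (show u ∈ Metric.ball 1 δ by simpa [dist_eq_norm] using hu)
  have hmem : ∀ z : K, ‖z‖ ≤ 1 → z * l ∈ Metric.eball (0 : K) (expSeries K K).radius := by
    intro z hz
    rw [Metric.mem_eball, edist_zero_right] at hl ⊢
    refine lt_of_le_of_lt ?_ hl
    rw [enorm_le_iff_norm_le, norm_mul]
    exact mul_le_of_le_one_left (norm_nonneg _) hz
  refine ⟨fun z => exp (z * l), fun z hz => ?_, fun k => ?_⟩
  · exact (analyticAt_exp_of_mem_ball (z * l) (hmem z hz)).fun_comp (f := fun z => z * l) (analyticAt_id.mul analyticAt_const)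
  · induction k with
    | zero => simp
    | succ k ih =>
      rw [pow_succ, ← ih, ← hlu]
      push_cast
      rw [add_mul, one_mul, exp_add_of_mem_ball (𝕂 := K) (hmem _ (IsUltrametricDist.norm_natCast_le_one K k)) hl]

lemma U3_near_one {K : Type*} [NontriviallyNormedField K] [ProperSpace K]
    (r s t : K) (hr : ‖r‖ = 1) (hs : ‖s‖ = 1) (ht : ‖t‖ = 1) (δ : ℝ) (hδ : 0 < δ) :
    ∃ N : ℕ, 0 < N ∧ ‖r ^ N - 1‖ < δ ∧ ‖s ^ N - 1‖ < δ ∧ ‖t ^ N - 1‖ < δ := by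
  have hb : ∀ n : ℕ, ((r ^ n, s ^ n, t ^ n) : K × K × K) ∈ Metric.closedBall (0 : K × K × K) 1 := by
    intro n
    simp [Prod.norm_def, hr, hs, ht]
  obtain ⟨a, -, φ, hφ, hlim⟩ := (isCompact_closedBall (0 : K × K × K) 1).tendsto_subseq hb
  have hc := hlim.cauchySeq
  rw [Metric.cauchySeq_iff'] at hc
  obtain ⟨n, hn⟩ := hc δ hδ
  have h1 := hn (n + 1) (by omega)
  have hlt : φ n < φ (n + 1) := hφ (by omega)
  simp only [Function.comp_apply, Prod.dist_eq, max_lt_iff] at h1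
  simp only [dist_eq_norm] at h1
  have key : ∀ x : K, ‖x‖ = 1 → ‖x ^ φ (n + 1) - x ^ φ n‖ < δ →
      ‖x ^ (φ (n + 1) - φ n) - 1‖ < δ := by
    intro x hx h
    have : x ^ φ (n + 1) - x ^ φ n = x ^ φ n * (x ^ (φ (n + 1) - φ n) - 1) := by
      rw [mul_sub, ← pow_add, Nat.add_sub_cancel' hlt.le, mul_one]
    rwa [this, norm_mul, norm_pow, hx, one_pow, one_mul] at h
  exact ⟨φ (n + 1) - φ n, by omega, key r hr h1.1, key s hs h1.2.1, key t ht h1.2.2⟩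

lemma U3_padic {p : ℕ} [hp : Fact p.Prime] {K : Type*} [NontriviallyNormedField K]
    [ProperSpace K] [IsUltrametricDist K] [NormedAlgebra ℚ_[p] K]
    (r s t : K) (hr : ‖r‖ = 1) (hs : ‖s‖ = 1) (ht : ‖t‖ = 1)
    (hinf : {m : ℕ | (1 + r ^ m) * (1 + s ^ m) = t ^ m}.Infinite) :
    ∃ n : ℕ, 0 < n ∧ r ^ n = 1 ∧ s ^ n = 1 ∧ t ^ n = 1 := by
  have : CharZero K := (RingHom.charZero_iff (algebraMap ℚ_[p] K).injective).mp inferInstance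
  have hr0 : r ≠ 0 := by rintro rfl; simp at hr
  have hs0 : s ≠ 0 := by rintro rfl; simp at hs
  have ht0 : t ≠ 0 := by rintro rfl; simp at ht
  obtain ⟨δ, hδ, hexp⟩ := U3_exp (p := p) (K := K)
  obtain ⟨N, hN, hrN, hsN, htN⟩ := U3_near_one r s t hr hs ht δ hδ
  obtain ⟨F, hF, hFk⟩ := hexp _ hrN
  obtain ⟨G, hG, hGk⟩ := hexp _ hsN
  obtain ⟨H, hH, hHk⟩ := hexp _ htN
  obtain ⟨a, ha⟩ : ∃ a : ℕ, {k : ℕ | (1 + r ^ (a + N * k)) * (1 + s ^ (a + N * k)) =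
      t ^ (a + N * k)}.Infinite := by
    by_contra hcon
    push Not at hcon
    apply hinf
    refine Set.Finite.subset (Set.Finite.biUnion (Set.finite_lt_nat N)
      (t := fun a => Set.image (fun k => a + N * k) {k : ℕ | (1 + r ^ (a + N * k)) * (1 + s ^ (a + N * k)) =
      t ^ (a + N * k)}) (fun a _ => (hcon a).image _)) ?_
    intro m hm
    simp only [Set.mem_iUnion]
    refine ⟨m % N, Nat.mod_lt _ hN, m / N, ?_, Nat.mod_add_div m N⟩
    simp only [Set.mem_ofPred_eq, Nat.mod_add_div]
    exact hm
  set f : K → K := fun z => (1 + r ^ a * F z) * (1 + s ^ a * G z) - t ^ a * H z with hf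
  have hfan : ∀ z, ‖z‖ ≤ 1 → AnalyticAt K f z := by
    intro z hz
    have := hF z hz
    have := hG z hz
    have := hH z hz
    fun_prop
  have hfk : ∀ k : ℕ, f k = (1 + r ^ (a + N * k)) * (1 + s ^ (a + N * k)) - t ^ (a + N * k) := by
    intro k
    simp only [hf, hFk, hGk, hHk, pow_add, pow_mul]
  set M := {k : ℕ | (1 + r ^ (a + N * k)) * (1 + s ^ (a + N * k)) = t ^ (a + N * k)} with hM
  have hinf' : (Set.image (fun k : ℕ => (k : K)) M).Infinite := ha.image Nat.cast_injective.injOn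
  obtain ⟨z, hz, hacc⟩ := hinf'.exists_accPt_of_subset_isCompact (isCompact_closedBall (0 : K) 1)
    (by rintro _ ⟨k, -, rfl⟩; simpa using IsUltrametricDist.norm_natCast_le_one K k)
  have hz1 : ‖z‖ ≤ 1 := by simpa using hz
  have hfreq := accPt_iff_frequently_nhdsNE.mp hacc
  have hev : ∀ᶠ x in nhds z, f x = 0 := by
    refine (hfan z hz1).frequently_zero_iff_eventually_zero.mp (hfreq.mono ?_)
    rintro _ ⟨k, hk, rfl⟩
    simp only [hfk]
    exact sub_eq_zero.mpr hk
  obtain ⟨ε, hε, hball⟩ := Metric.eventually_nhds_iff.mp hev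
  have hfr2 : ∃ᶠ x in nhds z, x ∈ (Set.image (fun k : ℕ => (k : K)) M) := hfreq.filter_mono nhdsWithin_le_nhds
  obtain ⟨_, hk0, k0, -, rfl⟩ := 
    (Filter.Eventually.and_frequently (Metric.ball_mem_nhds z hε : ∀ᶠ x in nhds z, x ∈ Metric.ball z ε)
      hfr2).exists
  have hpn : ‖(p : K)‖ < 1 := by
    rw [← map_natCast (algebraMap ℚ_[p] K), norm_algebraMap']
    exact Padic.norm_p_lt_one
  obtain ⟨n, hn⟩ := exists_pow_lt_of_lt_one hε hpn
  have hzero : ∀ j : ℕ, f ((k0 + p ^ n * j : ℕ) : K) = 0 := by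
    intro j
    apply hball
    have hk0' : dist (k0 : K) z < ε := hk0
    refine lt_of_le_of_lt (IsUltrametricDist.dist_triangle_max _ (k0 : K) _) (max_lt ?_ hk0')
    rw [dist_eq_norm]
    push_cast
    rw [add_sub_cancel_left, norm_mul, norm_pow]
    exact lt_of_le_of_lt (mul_le_of_le_one_right (by positivity)
      (IsUltrametricDist.norm_natCast_le_one K j)) hn
  have hpos : 0 < N * p ^ n := Nat.mul_pos hN (pow_pos hp.1.pos n)
  obtain ⟨h1, h2, h3⟩ := U3_alg (r ^ (a + N * k0)) (s ^ (a + N * k0)) (t ^ (a + N * k0))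
    (r ^ (N * p ^ n)) (s ^ (N * p ^ n)) (t ^ (N * p ^ n)) (pow_ne_zero _ hr0) (pow_ne_zero _ hs0)
    (pow_ne_zero _ ht0) (pow_ne_zero _ hr0) (pow_ne_zero _ hs0) (by
      intro j
      have := hzero j
      rw [hfk, sub_eq_zero] at this
      simp only [← pow_mul, ← pow_add]
      have e : a + N * k0 + N * p ^ n * j = a + N * (k0 + p ^ n * j) := by ring
      rw [e]
      exact this)
  exact ⟨N * p ^ n * 2, by omega, by rw [pow_mul, h1], by rw [pow_mul, h2], by rw [pow_mul, h3]⟩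

lemma U3_algcl {p : ℕ} [hp : Fact p.Prime] 
    (r s t : PadicAlgCl p) (hr : ‖r‖ = 1) (hs : ‖s‖ = 1) (ht : ‖t‖ = 1)
    (hinf : {m : ℕ | (1 + r ^ m) * (1 + s ^ m) = t ^ m}.Infinite) :
    ∃ n : ℕ, 0 < n ∧ r ^ n = 1 ∧ s ^ n = 1 ∧ t ^ n = 1 := by
  let E := IntermediateField.adjoin ℚ_[p] ({r, s, t} : Set (PadicAlgCl p))
  have hfin : FiniteDimensional ℚ_[p] E := by
    have : Finite ({r, s, t} : Set (PadicAlgCl p)) := Set.Finite.to_subtype (by simp)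
    exact IntermediateField.finiteDimensional_adjoin
      (fun x _ => (Algebra.IsAlgebraic.isAlgebraic x).isIntegral)
  let : NontriviallyNormedField E :=
    { (inferInstance : NormedField E) with
      non_trivial := by
        obtain ⟨x, hx⟩ := NontriviallyNormedField.non_trivial (α := ℚ_[p])
        refine ⟨algebraMap ℚ_[p] E x, ?_⟩
        change 1 < ‖algebraMap ℚ_[p] (PadicAlgCl p) x‖
        rw [PadicAlgCl.norm_extends]
        exact hx }
  let : NormedAlgebra ℚ_[p] E := 
    { (inferInstance : Algebra ℚ_[p] E) with
      norm_smul_le := fun a x => norm_smul_le a (x : PadicAlgCl p) }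
  have : ProperSpace E := FiniteDimensional.proper ℚ_[p] E
  have : IsUltrametricDist E := ⟨fun x y z => 
    IsUltrametricDist.dist_triangle_max (x : PadicAlgCl p) y z⟩
  have hrE : r ∈ E := IntermediateField.subset_adjoin _ _ (by simp)
  have hsE : s ∈ E := IntermediateField.subset_adjoin _ _ (by simp)
  have htE : t ∈ E := IntermediateField.subset_adjoin _ _ (by simp)
  obtain ⟨n, hn, h1, h2, h3⟩ := U3_padic (p := p) (K := E) ⟨r, hrE⟩ ⟨s, hsE⟩ ⟨t, htE⟩ hr hs ht (by
    refine hinf.mono ?_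
    intro m hm
    exact Subtype.ext hm)
  exact ⟨n, hn, congrArg Subtype.val h1, congrArg Subtype.val h2, congrArg Subtype.val h3⟩

open Polynomial in
lemma U3_unit_aux {R L : Type*} [CommRing R] [NormedField L] [IsUltrametricDist L] (i : R →+* L)
    (hi : ∀ c, ‖i c‖ ≤ 1) (x : L) (q : R[X]) (hq : q.eval₂ i x = 0) (h0 : ‖i (q.coeff 0)‖ = 1) :
    1 ≤ ‖x‖ := by
  by_contra hx
  push Not at hx
  have hb : ∀ g : R[X], ‖g.eval₂ i x‖ ≤ 1 := by
    intro g
    induction g using Polynomial.induction_on' with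
    | add p q hp hq => 
      rw [eval₂_add]
      exact (IsUltrametricDist.norm_add_le_max _ _).trans (max_le hp hq)
    | monomial n k =>
      rw [eval₂_monomial, norm_mul, norm_pow]
      exact mul_le_one₀ (hi k) (by positivity) (pow_le_one₀ (norm_nonneg _) hx.le)
  rw [← divX_mul_X_add q, eval₂_add, eval₂_mul, eval₂_X, eval₂_C] at hq
  have : i (q.coeff 0) = - (eval₂ i x q.divX * x) := by linear_combination hq
  rw [this, norm_neg, norm_mul] at h0
  have := mul_le_mul_of_nonneg_right (hb q.divX) (norm_nonneg x)
  linarith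

open Polynomial in
lemma U3_unit {R L : Type*} [CommRing R] [NormedField L] [IsUltrametricDist L] (i : R →+* L)
    (hi : ∀ c, ‖i c‖ ≤ 1) (x : L) (q : R[X]) (hq : q.eval₂ i x = 0) 
    (h0 : ‖i (q.leadingCoeff * q.coeff 0)‖ = 1) :
    ‖x‖ = 1 := by
  rw [map_mul, norm_mul] at h0
  have hl := hi q.leadingCoeff
  have hc := hi (q.coeff 0)
  have h1 : ‖i q.leadingCoeff‖ = 1 := by nlinarith [norm_nonneg (i q.leadingCoeff), norm_nonneg (i (q.coeff 0))]
  have h2 : ‖i (q.coeff 0)‖ = 1 := by rwa [h1, one_mul] at h0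
  have hx := U3_unit_aux i hi x q hq h2
  have hx0 : x ≠ 0 := by rintro rfl; simp at hx; linarith
  let := invertibleOfNonzero hx0
  have hx' := U3_unit_aux i hi (⅟x) q.reverse ((eval₂_reverse_eq_zero_iff i x q).mpr hq)
    (by rw [coeff_zero_reverse]; exact h1)
  rw [invOf_eq_inv, norm_inv] at hx'
  exact le_antisymm ((one_le_inv₀ (by positivity)).mp hx') hx

open Polynomial in
lemma U3_prime (h : ℤ[X]) (hh : h ≠ 0) : ∃ (p : ℕ) (_ : Fact p.Prime) (x : ℚ_[p]),
    Transcendental ℤ x ∧ ‖x‖ ≤ 1 ∧ ‖aeval x h‖ = 1 := by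
  obtain ⟨n, hn⟩ : ∃ n : ℤ, h.eval n ≠ 0 := by
    by_contra hcon
    push Not at hcon
    exact hh (Polynomial.funext (by simpa using hcon))
  obtain ⟨p, hpn, hp⟩ := Nat.exists_infinite_primes ((h.eval n).natAbs + 1)
  have : Fact p.Prime := ⟨hp⟩
  have hcount := Algebraic.countable ℤ ℚ_[p]
  have hd := hcount.dense_compl ℚ_[p]
  obtain ⟨x, hx, hxt⟩ := Metric.dense_iff.mp hd (n : ℚ_[p]) 1 one_pos
  have hx1 : ‖x - n‖ < 1 := by simpa [dist_eq_norm] using hx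
  have hxle : ‖x‖ ≤ 1 := by
    have : x = (x - n) + n := by ring
    rw [this]
    exact (IsUltrametricDist.norm_add_le_max _ _).trans (max_le hx1.le (Padic.norm_int_le_one n))
  refine ⟨p, ‹_›, x, hxt, hxle, ?_⟩
  have hhn : ‖((h.eval n : ℤ) : ℚ_[p])‖ = 1 := by
    refine le_antisymm (Padic.norm_int_le_one _) ?_
    by_contra hlt
    push Not at hlt
    rw [Padic.norm_intCast_lt_one_iff] at hlt
    have := Int.le_of_dvd (by positivity) ((dvd_abs _ _).mpr hlt)
    rw [Int.abs_eq_natAbs] at this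
    omega
  let y : ℤ_[p] := ⟨x, hxle⟩
  obtain ⟨d, hd⟩ := Polynomial.sub_dvd_eval_sub y (n : ℤ_[p]) (h.map (Int.castRingHom ℤ_[p]))
  have e1 : aeval x h = ((h.eval n : ℤ) : ℚ_[p]) + (x - n) * d := by
    have h1 : (((h.map (Int.castRingHom ℤ_[p])).eval y : ℤ_[p]) : ℚ_[p]) = aeval x h := by
      rw [eval_map, aeval_def]
      have := Polynomial.hom_eval₂ h (Int.castRingHom ℤ_[p]) (PadicInt.Coe.ringHom (p := p)) y
      refine this.trans ?_
      congr 1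
    have h2 : (h.map (Int.castRingHom ℤ_[p])).eval (n : ℤ_[p]) = ((h.eval n : ℤ) : ℤ_[p]) := by
      rw [eval_intCast_map]; simp
    rw [h2] at hd
    have := congrArg (fun z : ℤ_[p] => (z : ℚ_[p])) hd
    simp only [PadicInt.coe_sub, PadicInt.coe_mul, h1, PadicInt.coe_intCast] at this
    change _ = (x - n) * _ at this
    linear_combination this
  rw [e1]
  have hlt : ‖(x - n) * (d : ℚ_[p])‖ < 1 := by
    rw [norm_mul]
    exact lt_of_le_of_lt (mul_le_of_le_one_right (norm_nonneg _) (PadicInt.norm_le_one d)) hx1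
  rw [IsUltrametricDist.norm_add_eq_max_of_norm_ne_norm (by rw [hhn]; exact hlt.ne'), hhn]
  exact max_eq_left hlt.le

open Polynomial in
lemma U3_main (τ r s : ℂ) (hτ : Transcendental ℤ τ) (h : r * s * (1 + r) * (1 + s) ≠ 0)
    (hr : ∃ q : ℤ[X][X], q ≠ 0 ∧ q.eval₂ (aeval τ : ℤ[X] →ₐ[ℤ] ℂ).toRingHom r = 0)
    (hs : ∃ q : ℤ[X][X], q ≠ 0 ∧ q.eval₂ (aeval τ : ℤ[X] →ₐ[ℤ] ℂ).toRingHom s = 0)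
    (hinf : {m : ℕ | (1 + r ^ m) * (1 + s ^ m) = ((1 + r) * (1 + s)) ^ m}.Infinite) :
    ∃ n : ℕ, 0 < n ∧ r ^ n = 1 ∧ s ^ n = 1 ∧ ((1 + r) * (1 + s)) ^ n = 1 := by
  let : Algebra ℤ[X] ℂ := (aeval τ : ℤ[X] →ₐ[ℤ] ℂ).toRingHom.toAlgebra
  have hinjτ : Function.Injective (algebraMap ℤ[X] ℂ) := transcendental_iff_injective.mp hτ
  have : Module.IsTorsionFree ℤ[X] ℂ := Module.isTorsionFree_iff_algebraMap_injective.mpr hinjτ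
  have hrA : IsAlgebraic ℤ[X] r := hr
  have hsA : IsAlgebraic ℤ[X] s := hs
  have key : ∀ x : ℂ, x ≠ 0 → IsAlgebraic ℤ[X] x → ∃ q : ℤ[X][X], q.leadingCoeff * q.coeff 0 ≠ 0 ∧
      aeval x q = 0 := by
    intro x hx hA
    obtain ⟨q, hq0, hq⟩ := hA.exists_nonzero_coeff_and_aeval_eq_zero (mem_nonZeroDivisors_of_ne_zero hx)
    refine ⟨q, mul_ne_zero ?_ hq0, hq⟩
    rw [leadingCoeff_ne_zero]
    rintro rfl
    simp at hq0
  simp only [mul_ne_zero_iff] at h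
  obtain ⟨⟨⟨hr0, hs0⟩, hr1⟩, hs1⟩ := h
  have h1A : IsAlgebraic ℤ[X] (1 : ℂ) := isAlgebraic_one
  obtain ⟨q1, hq1, e1⟩ := key r hr0 hrA
  obtain ⟨q2, hq2, e2⟩ := key s hs0 hsA
  obtain ⟨q3, hq3, e3⟩ := key (1 + r) hr1 (h1A.add hrA)
  obtain ⟨q4, hq4, e4⟩ := key (1 + s) hs1 (h1A.add hsA)
  obtain ⟨p, hp, ρ, hρ, hρ1, hh⟩ := U3_prime _ (mul_ne_zero (mul_ne_zero hq1 hq2) (mul_ne_zero hq3 hq4))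
  let L := PadicAlgCl p
  let i : ℤ[X] →+* L := (algebraMap ℚ_[p] L).comp (aeval ρ : ℤ[X] →ₐ[ℤ] ℚ_[p]).toRingHom
  let : Algebra ℤ[X] L := i.toAlgebra
  have hinji : Function.Injective (algebraMap ℤ[X] L) :=
    (algebraMap ℚ_[p] L).injective.comp (transcendental_iff_injective.mp hρ)
  have : Module.IsTorsionFree ℤ[X] L := Module.isTorsionFree_iff_algebraMap_injective.mpr hinji
  have hnorm : ∀ c, ‖i c‖ = ‖aeval ρ c‖ := fun c => PadicAlgCl.norm_extends p _
  have hi : ∀ c, ‖i c‖ ≤ 1 := by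
    intro c
    rw [hnorm]
    induction c using Polynomial.induction_on' with
    | add p q hp hq =>
      rw [map_add]
      exact (IsUltrametricDist.norm_add_le_max _ _).trans (max_le hp hq)
    | monomial n k =>
      rw [aeval_monomial, norm_mul, norm_pow]
      exact mul_le_one₀ (by simpa using Padic.norm_int_le_one k) (by positivity)
        (pow_le_one₀ (norm_nonneg _) hρ1)
  rw [← hnorm] at hh
  have hsplit : ∀ a b, ‖i (a * b)‖ = 1 → ‖i a‖ = 1 ∧ ‖i b‖ = 1 := by
    intro a b hab
    rw [map_mul, norm_mul] at hab
    have h1 := hi a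
    have h2 := hi b
    have h3 : ‖i a‖ = 1 := by nlinarith [norm_nonneg (i a), norm_nonneg (i b)]
    exact ⟨h3, by rwa [h3, one_mul] at hab⟩
  obtain ⟨h12, h34⟩ := hsplit _ _ hh
  obtain ⟨g1, g2⟩ := hsplit _ _ h12
  obtain ⟨g3, g4⟩ := hsplit _ _ h34
  let S := Subalgebra.algebraicClosure ℤ[X] ℂ
  let φ : S →ₐ[ℤ[X]] L := IsAlgClosed.lift
  have hφinj : ∀ x : S, φ x = 0 → x = 0 := by
    intro x hx
    by_contra hx0
    obtain ⟨q, hq, hqe⟩ := key x (fun h => hx0 (Subtype.ext h)) x.2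
    have hqS : aeval x q = 0 := by
      apply Subtype.val_injective
      rw [← Subalgebra.coe_val, ← aeval_algHom_apply]
      exact hqe
    have h0 : aeval (φ x) q = 0 := by rw [aeval_algHom_apply, hqS, map_zero]
    rw [hx, ← coeff_zero_eq_aeval_zero'] at h0
    exact hq (by rw [(map_eq_zero_iff _ hinji).mp h0, mul_zero])
  have hunit : ∀ (x : S) (q : ℤ[X][X]), aeval (x : ℂ) q = 0 →
      ‖i (q.leadingCoeff * q.coeff 0)‖ = 1 → ‖φ x‖ = 1 := by
    intro x q hqe hq
    have hqS : aeval x q = 0 := by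
      apply Subtype.val_injective
      rw [← Subalgebra.coe_val, ← aeval_algHom_apply]
      exact hqe
    have h0 : aeval (φ x) q = 0 := by rw [aeval_algHom_apply, hqS, map_zero]
    exact U3_unit i hi (φ x) q h0 hq
  let r' : S := ⟨r, hrA⟩
  let s' : S := ⟨s, hsA⟩
  have n1 := hunit r' q1 e1 g1
  have n2 := hunit s' q2 e2 g2
  have n3 := hunit (1 + r') q3 e3 g3
  have n4 := hunit (1 + s') q4 e4 g4
  obtain ⟨n, hn, f1, f2, f3⟩ := U3_algcl (φ r') (φ s') (φ ((1 + r') * (1 + s'))) n1 n2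
    (by rw [map_mul, norm_mul, n3, n4, one_mul]) (by
      refine hinf.mono ?_
      intro m hm
      have hm' : (1 + r' ^ m) * (1 + s' ^ m) = ((1 + r') * (1 + s')) ^ m := Subtype.ext hm
      have := congrArg φ hm'
      simp only [Set.mem_ofPred_eq]
      rw [← map_pow φ ((1 + r') * (1 + s')), ← this]
      simp)
  have back : ∀ x : S, φ x ^ n = 1 → (x : ℂ) ^ n = 1 := by
    intro x hx
    have := hφinj (x ^ n - 1) (by rw [map_sub, map_pow, map_one, hx, sub_self])
    exact congrArg Subtype.val (sub_eq_zero.mp this)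
  exact ⟨n, hn, back r' f1, back s' f2, back _ f3⟩

open Polynomial in
lemma U3_tr (r s : ℂ) (h : r * s * (1 + r) * (1 + s) ≠ 0) (hr : Transcendental ℤ r)
    (hinf : {m : ℕ | (1 + r ^ m) * (1 + s ^ m) = ((1 + r) * (1 + s)) ^ m}.Infinite) :
    ∃ n : ℕ, 0 < n ∧ r ^ n = 1 ∧ s ^ n = 1 ∧ ((1 + r) * (1 + s)) ^ n = 1 := by
  refine U3_main r r s hr h ⟨X - C X, X_sub_C_ne_zero _, by simp⟩ ?_ hinf
  obtain ⟨m, hm, hm2⟩ := hinf.exists_gt 1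
  refine ⟨C (1 + X ^ m) * (1 + X ^ m) - C ((1 + X) ^ m) * (1 + X) ^ m, ?_, ?_⟩
  · intro h0
    have h1 := congrArg (fun q : ℤ[X][X] => (q.eval 0).eval 1) h0
    have hm0 : m ≠ 0 := by omega
    simp [hm0] at h1
    have : (2 : ℤ) ^ 1 < 2 ^ m := pow_lt_pow_right₀ (by norm_num) hm2
    norm_num at h1 this
    linarith
  · have hm' : (1 + r ^ m) * (1 + s ^ m) = ((1 + r) * (1 + s)) ^ m := hm
    rw [mul_pow] at hm'
    simp only [eval₂_sub, eval₂_mul, eval₂_C, eval₂_add, eval₂_pow, eval₂_one, eval₂_X]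
    simp [hm']

open Polynomial in
lemma U3_lift (τ r : ℂ) (hr : IsAlgebraic ℤ r) :
    ∃ q : ℤ[X][X], q ≠ 0 ∧ q.eval₂ (aeval τ : ℤ[X] →ₐ[ℤ] ℂ).toRingHom r = 0 := by
  obtain ⟨q, hq, hqe⟩ := hr
  refine ⟨q.map C, (Polynomial.map_ne_zero_iff C_injective).mpr hq, ?_⟩
  rw [eval₂_map, ← hqe, aeval_def]
  congr 1
  exact RingHom.ext_int _ _

theorem U3_roots_of_unity (r s : ℂ) (h : r * s * (1 + r) * (1 + s) ≠ 0)
    (hinf : {m : ℕ | (1 + r ^ m) * (1 + s ^ m) = ((1 + r) * (1 + s)) ^ m}.Infinite) :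
    IsRootOfUnity r ∧ IsRootOfUnity s ∧ IsRootOfUnity ((1 + r) * (1 + s)) := by
  suffices hmain : ∃ n : ℕ, 0 < n ∧ r ^ n = 1 ∧ s ^ n = 1 ∧ ((1 + r) * (1 + s)) ^ n = 1 by
    obtain ⟨n, hn, h1, h2, h3⟩ := hmain
    exact ⟨⟨n, hn, h1⟩, ⟨n, hn, h2⟩, ⟨n, hn, h3⟩⟩
  by_cases hr : IsAlgebraic ℤ r
  · by_cases hs : IsAlgebraic ℤ s
    · have hτ : Transcendental ℤ ((liouvilleNumber (2 : ℕ) : ℝ) : ℂ) := by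
        have := transcendental_liouvilleNumber (le_refl 2)
        intro hA
        exact this ((isAlgebraic_algebraMap_iff (A := ℂ) (algebraMap ℝ ℂ).injective).mp hA)
      exact U3_main _ r s hτ h (U3_lift _ r hr) (U3_lift _ s hs) hinf
    · obtain ⟨n, hn, h1, h2, h3⟩ := U3_tr s r (by convert h using 1; ring) hs
        (by
          convert hinf using 4 with m
          · ring
          · ring)
      exact ⟨n, hn, h2, h1, by rw [mul_comm]; exact h3⟩
  · exact U3_tr r s h hr hinf
end
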